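/- arXiv:2407.04030 — 3 statements merged into one kernel-verified Lean document; each statement's English description precedes it below -/
import Mathlib

section
/- Let M be a finite nonempty metric space with n points. For every k ≥ 1 and every finite nonempty metric space B there exists a finite nonempty metric space C such that for every coloring χ : NESurj(C, M) → Fin k there exists a non-expansive surjection w : C → B for which the set {χ(f ∘ w) : f ∈ NESurj(B, M)} has at most n! elements. (In other words, the dual small Ramsey degree of M with respect to non-expansive surjections is at most |M|!.) -/
/-- A non-expansive surjection between metric spaces. -/
def IsNESurj {X Y : Type*} [MetricSpace X] [MetricSpace Y] (f : X → Y) : Prop :=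
  Function.Surjective f ∧ ∀ x y : X, dist (f x) (f y) ≤ dist x y

/-- `C ⟶ (B)^M_{k,t}` for non-expansive surjections: every `k`-coloring of the
non-expansive surjections `C → M` takes at most `t` values on some set of the form
`{f ∘ w : f ∈ NESurj(B, M)}` with `w ∈ NESurj(C, B)`. -/
def DualArrow (C M B : Type) [MetricSpace C] [MetricSpace M] [MetricSpace B]
    (k t : ℕ) : Prop :=
  ∀ χ : {f : C → M // IsNESurj f} → Fin k,
    ∃ w : C → B, IsNESurj w ∧
      {c : Fin k | ∃ g : {f : C → M // IsNESurj f},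
        (∃ f : B → M, IsNESurj f ∧ g.1 = f ∘ w) ∧ χ g = c}.ncard ≤ t


/-- `f` has value `v` at `p`, and only smaller values before `p`. -/
def FirstAt (f : ℕ → ℕ) (v p : ℕ) : Prop := f p = v ∧ ∀ i < p, f i < v

/-- Parameter words of length `n` with letters `< a` and parameters in `[a, k)`. -/
structure Wd (a k n : ℕ) (f : ℕ → ℕ) : Prop where
  fix : ∀ i < a, f i = i
  lt : ∀ i < n, f i < k
  zero : ∀ i, n ≤ i → f i = 0
  first : ∀ v < k, ∃ p < n, FirstAt f v p

/-- Truncation. -/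
def trunc (n : ℕ) (f : ℕ → ℕ) : ℕ → ℕ := fun i => if i < n then f i else 0

theorem FirstAt.comp {f g : ℕ → ℕ} {v p q : ℕ} (hf : FirstAt f v p) (hg : FirstAt g p q) :
    FirstAt (f ∘ g) v q :=
  ⟨by simp [hg.1, hf.1], fun i hi => hf.2 _ (hg.2 i hi)⟩

theorem Wd.comp {a k m n : ℕ} {f g : ℕ → ℕ} (ha : 1 ≤ a) (hf : Wd a k m f) (hg : Wd a m n g) :
    Wd a k n (f ∘ g) where
  fix i hi := by simp [hg.fix i hi, hf.fix i hi]
  lt i hi := hf.lt _ (hg.lt i hi)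
  zero i hi := by simp [hg.zero i hi, hf.fix 0 ha]
  first v hv := by
    obtain ⟨p, hp, h1⟩ := hf.first v hv
    obtain ⟨q, hq, h2⟩ := hg.first p hp
    exact ⟨q, hq, h1.comp h2⟩

theorem wd_id {a n : ℕ} (h : a ≤ n) : Wd a n n (trunc n id) where
  fix i hi := by simp [trunc]; omega
  lt i hi := by simp [trunc, hi]
  zero i hi := by simp [trunc]; omega
  first v hv := ⟨v, hv, by simp [trunc, hv], fun i hi => by simp [trunc]; split_ifs <;> omega⟩

instance wd_finite (a k n : ℕ) : Finite {u // Wd a k n u} := by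
  refine Finite.of_injective
    (fun u : {u // Wd a k n u} => fun i : Fin n => (⟨u.1 i, u.2.lt i i.2⟩ : Fin k)) ?_
  intro u v h
  ext i
  by_cases hi : i < n
  · have := congrFun h ⟨i, hi⟩
    simpa using this
  · rw [u.2.zero i (by omega), v.2.zero i (by omega)]

theorem hj (a : ℕ) (κ : Type) [Finite κ] : ∃ l : ℕ, ∀ C : (ℕ → ℕ) → κ, ∃ L : ℕ → ℕ,
    (∀ i < l, L i ≤ a) ∧ (∃ i < l, L i = a) ∧ ∀ x < a, ∀ y < a,
      C (fun i => if i < l then (if L i = a then x else L i) else 0) =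
      C (fun i => if i < l then (if L i = a then y else L i) else 0) := by
  obtain ⟨ι, _, h⟩ := Combinatorics.Line.exists_mono_in_high_dimension (Fin a) κ
  let e := Fintype.equivFin ι
  refine ⟨Fintype.card ι, fun C => ?_⟩
  obtain ⟨l, c, hl⟩ := h (fun z => C (fun i =>
    if hi : i < Fintype.card ι then (z (e.symm ⟨i, hi⟩) : ℕ) else 0))
  refine ⟨fun i => if hi : i < Fintype.card ι then
    (match l.idxFun (e.symm ⟨i, hi⟩) with | none => a | some b => (b : ℕ)) else 0, ?_, ?_, ?_⟩
  · intro i hi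
    simp only [hi, dif_pos]
    split
    · exact le_rfl
    · rename_i b _
      exact b.2.le
  · obtain ⟨i, hi⟩ := l.proper
    refine ⟨e i, (e i).2, ?_⟩
    simp [hi]
  · have key : ∀ x (hx : x < a), C (fun i => if i < Fintype.card ι then
        (if (if hi : i < Fintype.card ι then
          (match l.idxFun (e.symm ⟨i, hi⟩) with | none => a | some b => (b : ℕ)) else 0) = a
          then x else (if hi : i < Fintype.card ι then
          (match l.idxFun (e.symm ⟨i, hi⟩) with | none => a | some b => (b : ℕ)) else 0))
        else 0) = c := by
      intro x hx
      rw [← hl ⟨x, hx⟩]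
      congr 1
      ext i
      by_cases hi : i < Fintype.card ι
      · simp only [hi, if_true, dif_pos]
        rcases hb : l.idxFun (e.symm ⟨i, hi⟩) with _ | b
        · simp [Combinatorics.Line.apply_def, hb]
        · have := b.2.ne
          simp [Combinatorics.Line.apply_def, hb, this]
      · simp [hi]
    intro x hx y hy
    exact (key x hx).trans (key y hy).symm

theorem blocks (a : ℕ) (ha : 1 ≤ a) (T : ℕ) : ∀ (κ : Type) [Finite κ], ∃ n, a ≤ n ∧
    ∀ c : ℕ → (ℕ → ℕ) → κ, ∃ (h : ℕ → ℕ) (q : ℕ → ℕ), Wd a (a + T) n h ∧ q (a + T) = n ∧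
      (∀ j, a ≤ j → j < a + T → q j < n ∧ FirstAt h j (q j)) ∧
      ∀ j, a ≤ j → j ≤ a + T → ∀ x x', Wd a a j x → Wd a a j x' →
        c (q j) (trunc (q j) (x ∘ h)) = c (q j) (trunc (q j) (x' ∘ h)) := by
  induction T with
  | zero =>
    intro κ _
    refine ⟨a, le_rfl, fun c => ⟨trunc a id, id, wd_id le_rfl, rfl, ?_, ?_⟩⟩
    · intro j h1 h2; omega
    · intro j h1 h2 x x' hx hx'
      congr 1
      ext i
      simp only [trunc, Function.comp]
      have : j = a := by omega
      subst this
      by_cases hi : i < j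
      · simp [hi, hx.fix i hi, hx'.fix i hi]
      · simp [hi]
  | succ T ih =>
    intro κ _
    obtain ⟨n, han, hn⟩ := ih (κ × κ × κ)
    obtain ⟨l, hl⟩ := hj a ({u // Wd a a n u} → κ)
    refine ⟨n + l, by omega, fun c => ?_⟩
    obtain ⟨L, hL1, hL2, hL3⟩ := hl (fun z u => c (n + l)
      (fun i => if i < n then u.1 i else z (i - n)))
    classical
    -- first occurrence of the variable
    obtain ⟨s, hs, hsL, hsmin⟩ : ∃ s < l, L s = a ∧ ∀ i < s, L i < a := by
      refine ⟨Nat.find hL2, (Nat.find_spec hL2).1, (Nat.find_spec hL2).2, fun i hi => ?_⟩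
      have h1 := Nat.find_min hL2 hi
      have h2 := (Nat.find_spec hL2).1
      have h3 := hL1 i (by omega)
      rcases h3.lt_or_eq with h | h
      · exact h
      · exact absurd ⟨by omega, h⟩ h1
    obtain ⟨h, q, hW, hqn, hq, hcol⟩ := hn (fun p u => (c p u,
      c (n + s) (fun i => if i < n then u i else if i < n + s then L (i - n) else 0),
      c (n + l) (fun i => if i < n then u i else
        if i - n < l then (if L (i - n) = a then 0 else L (i - n)) else 0)))
    let H : ℕ → ℕ := fun i => if i < n then h i else
      if i < n + l then (if L (i - n) = a then a + T else L (i - n)) else 0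
    let Q : ℕ → ℕ := fun j => if j < a + T then q j else if j = a + T then n + s else n + l
    have hHs : FirstAt H (a + T) (n + s) := by
      constructor
      · simp [H, hsL, hs]
      · intro i hi
        simp only [H]
        split_ifs with h1 h2 h3
        · exact hW.lt i h1
        · have := hsmin (i - n) (by omega); omega
        · have := hsmin (i - n) (by omega); omega
        · omega
    have hHq : ∀ j, ∀ p < n, FirstAt h j p → FirstAt H j p := by
      intro j p hp hj
      refine ⟨by simp [H, hp, hj.1], fun i hi => ?_⟩
      have : i < n := by omega
      simp [H, this, hj.2 i hi]
    have hWH : Wd a (a + (T + 1)) (n + l) H := by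
      refine ⟨?_, ?_, ?_, ?_⟩
      · intro i hi
        have : i < n := by omega
        simp [H, this, hW.fix i hi]
      · intro i hi
        simp only [H]
        split_ifs with h1 h2
        · have := hW.lt i h1; omega
        · omega
        · have := hL1 (i - n) (by omega); omega
      · intro i hi
        simp only [H]
        rw [if_neg (by omega), if_neg (by omega)]
      · intro v hv
        by_cases hv' : v < a + T
        · obtain ⟨p, hp, h1⟩ := hW.first v hv'
          exact ⟨p, by omega, hHq v p hp h1⟩
        · have : v = a + T := by omega
          subst this
          exact ⟨n + s, by omega, hHs⟩
    refine ⟨H, Q, hWH, ?_, ?_, ?_⟩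
    · simp [Q]
    · intro j h1 h2
      by_cases hj : j < a + T
      · simp only [Q, hj, if_true]
        have := hq j h1 hj
        exact ⟨by omega, hHq j _ this.1 this.2⟩
      · have : j = a + T := by omega
        subst this
        simp only [Q, lt_irrefl, if_false, if_true]
        exact ⟨by omega, hHs⟩
    · intro j h1 h2 x x' hx hx'
      by_cases hj : j < a + T
      · have e1 := congrArg Prod.fst (hcol j h1 hj.le x x' hx hx')
        have e2 := (hq j h1 hj).1
        have e3 : ∀ y : ℕ → ℕ, trunc (q j) (y ∘ H) = trunc (q j) (y ∘ h) := by
          intro y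
          ext i
          simp only [trunc, Function.comp]
          split_ifs with h3
          · have : i < n := by omega
            simp [H, this]
          · rfl
        simp only [Q, hj, if_true, e3]
        exact e1
      by_cases hj' : j = a + T
      · subst hj'
        have e1 := congrArg (fun z => z.2.1) (hcol _ h1 le_rfl x x' hx hx')
        simp only [hqn] at e1
        have e3 : ∀ y : ℕ → ℕ, Wd a a (a + T) y → trunc (n + s) (y ∘ H) =
            (fun i => if i < n then trunc n (y ∘ h) i else
              if i < n + s then L (i - n) else 0) := by
          intro y hy
          ext i
          simp only [trunc, Function.comp, H]
          by_cases h3 : i < n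
          · simp [h3, show i < n + s by omega]
          · by_cases h4 : i < n + s
            · have := hsmin (i - n) (by omega)
              simp [h3, h4, show i < n + l by omega, this.ne, hy.fix _ this]
            · simp [h3, h4]
        simp only [Q, lt_irrefl, if_false, if_true]
        rw [e3 x hx, e3 x' hx']
        exact e1
      · have hjT : j = a + T + 1 := by omega
        subst hjT
        have tr : ∀ y, Wd a a (a + T + 1) y → Wd a a (a + T) (trunc (a + T) y) := by
          intro y hy
          refine ⟨?_, ?_, ?_, ?_⟩
          · intro i hi; simp [trunc, hy.fix i hi]; omega
          · intro i hi; simp [trunc, hi]; exact hy.lt i (by omega)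
          · intro i hi; simp [trunc]; omega
          · intro v hv
            refine ⟨v, by omega, ?_, fun i hi => ?_⟩
            · simp [trunc, hy.fix v hv]; omega
            · simp [trunc, hy.fix i (by omega)]; split_ifs <;> omega
        have e1 := congrArg (fun z => z.2.2) (hcol _ (by omega) le_rfl _ _ (tr x hx) (tr x' hx'))
        simp only [hqn] at e1
        have e3 : ∀ y : ℕ → ℕ, Wd a a (a + T + 1) y → c (n + l) (trunc (n + l) (y ∘ H)) =
            c (n + l) (fun i => if i < n then trunc n (trunc (a + T) y ∘ h) i else
              if i - n < l then (if L (i - n) = a then 0 else L (i - n)) else 0) := by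
          intro y hy
          have hu : Wd a a n (trunc (a + T) y ∘ h) := (tr y hy).comp ha hW
          have := congrFun (hL3 (y (a + T)) (hy.lt _ (by omega)) 0 (by omega)) ⟨_, hu⟩
          simp only at this
          refine Eq.trans ?_ (this.trans ?_)
          · congr 1
            ext i
            simp only [trunc, Function.comp, H]
            by_cases h3 : i < n
            · simp [h3, show i < n + l by omega, hW.lt i h3]
            · by_cases h4 : i < n + l
              · simp only [h3, h4, if_true, if_false, show i - n < l by omega]
                split_ifs with h5
                · rfl
                · have := hL1 (i - n) (by omega)
                  exact hy.fix _ (by omega)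
              · simp [h3, h4, show ¬ (i - n < l) by omega]
          · congr 1
            ext i
            by_cases h3 : i < n
            · simp [h3, trunc]
            · simp [h3]
        have hQ : Q (a + T + 1) = n + l := by simp [Q]
        rw [hQ, e3 x hx, e3 x' hx']
        exact e1

/-- Graham--Rothschild property. -/
def GR (k a : ℕ) : Prop := ∀ m, a ≤ m → ∀ (κ : Type) [Finite κ], ∃ n, a ≤ n ∧
  ∀ c : (ℕ → ℕ) → κ, ∃ g, Wd a m n g ∧ ∀ f f', Wd a k m f → Wd a k m f' →
    c (f ∘ g) = c (f' ∘ g)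

theorem gr_base (k : ℕ) (hk : 1 ≤ k) : GR k k := by
  intro m hm κ _
  obtain ⟨T, rfl⟩ := Nat.exists_eq_add_of_le hm
  obtain ⟨n, hn, H⟩ := blocks k hk T κ
  refine ⟨n, hn, fun c => ?_⟩
  obtain ⟨h, q, hW, hq, -, hc⟩ := H (fun _ u => c u)
  refine ⟨h, hW, fun f f' hf hf' => ?_⟩
  have := hc (k + T) (by omega) le_rfl f f' hf hf'
  have e : ∀ y, Wd k k (k + T) y → trunc n (y ∘ h) = y ∘ h := by
    intro y hy
    ext i
    simp only [trunc]
    split_ifs with h1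
    · rfl
    · exact ((hy.comp hk hW).zero i (by omega)).symm
  rw [hq, e f hf, e f' hf'] at this
  exact this

theorem FirstAt.ge {a k n v p : ℕ} {f : ℕ → ℕ} (hf : Wd a k n f) (h : FirstAt f v p)
    (hv : a ≤ v) : a ≤ p := by
  by_contra hp
  have := hf.fix p (by omega)
  have := h.1
  omega

theorem fusion (k a : ℕ) (ha : 1 ≤ a) (hak : a < k) (hP : GR k (a + 1)) (t : ℕ) :
    ∀ M, a + t ≤ M → ∀ (κ : Type) [Finite κ], ∃ n, a ≤ n ∧
    ∀ c : (ℕ → ℕ) → κ, ∃ g, Wd a M n g ∧ ∀ f f', Wd a k M f → Wd a k M f' →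
      ∀ p < a + t, FirstAt f a p → (∀ i ≤ p, f i = f' i) → c (f ∘ g) = c (f' ∘ g) := by
  induction t with
  | zero =>
    intro M hM κ _
    refine ⟨M, hM, fun c => ⟨trunc M id, wd_id hM, ?_⟩⟩
    intro f f' hf _ p hp h
    have := h.ge hf le_rfl
    omega
  | succ t ih =>
    intro M hM κ _
    obtain ⟨n', hn', H'⟩ := hP (M - t) (by omega) ({u // Wd a a (a + t) u} → κ)
    obtain ⟨n, hn, H⟩ := ih (n' + t) (by omega) κ
    refine ⟨n, hn, fun c => ?_⟩
    obtain ⟨g1, hg1, hc1⟩ := H c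
    obtain ⟨g', hg', hc'⟩ := H' (fun z u =>
      c ((fun i => if i < a + t then u.1 i else z (i - t)) ∘ g1))
    let ι : ℕ → ℕ := fun v => if v < a then v else v + t
    let h : ℕ → ℕ := fun i => if i < a + t then i else ι (g' (i - t))
    have hlt : ∀ i, i < a + t → h i = i := fun i hi => by simp [h, hi]
    have hat : h (a + t) = a + t := by
      simp [h, ι, hg'.fix a (by omega)]
    have hWh : Wd a M (n' + t) h := by
      refine ⟨?_, ?_, ?_, ?_⟩
      · intro i hi; exact hlt i (by omega)
      · intro i hi
        simp only [h, ι]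
        have := hg'.lt (i - t)
        split_ifs <;> omega
      · intro i hi
        have := hg'.zero (i - t) (by omega)
        simp only [h, ι, this]
        rw [if_neg (by omega), if_pos (by omega)]
      · intro v hv
        by_cases hv' : v < a + t
        · refine ⟨v, by omega, hlt v hv', fun i hi => ?_⟩
          rw [hlt i (by omega)]; exact hi
        · obtain ⟨q, hq, h1, h2⟩ := hg'.first (v - t) (by omega)
          have hqa : a ≤ q := by
            by_contra hp
            have := hg'.fix q (by omega)
            omega
          refine ⟨q + t, by omega, ?_, fun i hi => ?_⟩
          · simp only [h, ι, Nat.add_sub_cancel, h1]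
            split_ifs <;> omega
          · have := h2 (i - t)
            simp only [h, ι]
            split_ifs <;> omega
    refine ⟨h ∘ g1, hWh.comp ha hg1, ?_⟩
    intro f f' hf hf' p hp hfp hff
    have hpa := hfp.ge hf le_rfl
    by_cases hpt : p < a + t
    · refine hc1 (f ∘ h) (f' ∘ h) (hf.comp ha hWh) (hf'.comp ha hWh) p hpt ⟨?_, ?_⟩ ?_
      · simp [hlt p hpt, hfp.1]
      · intro i hi
        simp only [Function.comp, hlt i (by omega)]
        exact hfp.2 i hi
      · intro i hi
        simp only [Function.comp, hlt i (by omega)]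
        exact hff i hi
    · have hpe : p = a + t := by omega
      subst hpe
      have hfp' : FirstAt f' a (a + t) :=
        ⟨by rw [← hff _ le_rfl, hfp.1], fun i hi => by rw [← hff i hi.le]; exact hfp.2 i hi⟩
      have yW : ∀ y, Wd a k M y → FirstAt y a (a + t) → Wd (a + 1) k (M - t) (y ∘ ι) := by
        intro y hy hya
        refine ⟨?_, ?_, ?_, ?_⟩
        · intro i hi
          by_cases hia : i < a
          · simp [ι, hia, hy.fix i hia]
          · have : i = a := by omega
            subst this
            simp [ι, hya.1]
        · intro i hi
          refine hy.lt _ ?_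
          simp only [ι]
          split_ifs <;> omega
        · intro i hi
          refine hy.zero _ ?_
          simp only [ι]
          split_ifs <;> omega
        · intro v hv
          by_cases hva : v < a
          · refine ⟨v, by omega, by simp [ι, hva, hy.fix v hva], fun i hi => ?_⟩
            have : i < a := by omega
            simp [ι, this, hy.fix i this, hi]
          · obtain ⟨q, hq, h1, h2⟩ := hy.first v hv
            have hqa : a + t ≤ q := by
              by_contra hp
              have := hya.2 q (by omega)
              omega
            refine ⟨q - t, by omega, ?_, fun i hi => ?_⟩
            · simp only [ι, Function.comp]
              rw [if_neg (by omega), Nat.sub_add_cancel (by omega), h1]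
            · by_cases hia : i < a
              · simp only [ι, Function.comp, hia, if_true, hy.fix i hia]; omega
              · simp only [ι, Function.comp, hia, if_false]
                exact h2 _ (by omega)
      have hu : Wd a a (a + t) (trunc (a + t) f) := by
        refine ⟨?_, ?_, ?_, ?_⟩
        · intro i hi; simp [trunc, hf.fix i hi]; omega
        · intro i hi; simp only [trunc, hi, if_true]; exact hfp.2 i hi
        · intro i hi; simp [trunc]; omega
        · intro v hv
          refine ⟨v, by omega, ?_, fun i hi => ?_⟩
          · simp [trunc, hf.fix v hv]; omega
          · simp [trunc, hf.fix i (by omega)]; split_ifs <;> omega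
      have key := congrFun (hc' _ _ (yW f hf hfp) (yW f' hf' hfp')) ⟨_, hu⟩
      have e : ∀ y : ℕ → ℕ, (∀ i < a + t, y i = f i) →
          (fun i => if i < a + t then trunc (a + t) f i else ((y ∘ ι) ∘ g') (i - t)) = y ∘ h := by
        intro y hy
        ext i
        by_cases hi : i < a + t
        · simp [hi, h, trunc, hy i hi]
        · simp [hi, h]
      simp only at key
      rw [e f (fun _ _ => rfl), e f' (fun i hi => (hff i hi.le).symm)] at key
      exact key

theorem select (a s T : ℕ) (ha : 1 ≤ a) (S : Finset ℕ) (hS : S.card = s)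
    (hST : ∀ i ∈ S, a ≤ i ∧ i < a + T) :
    ∃ e, Wd a (a + s) (a + T) e ∧ ∀ v p, a ≤ v → FirstAt e v p → p ∈ S := by
  classical
  have hfin : {i | i ∈ S}.Finite := S.finite_toSet
  have hcard : hfin.toFinset.card = s := by rw [← hS]; congr 1; ext; simp
  let e : ℕ → ℕ := fun i => if i < a then i else if i ∈ S then a + Nat.count (· ∈ S) i else 0
  have hcnt : ∀ i ∈ S, Nat.count (· ∈ S) i < s := by
    intro i hi
    rw [← hcard]
    exact Nat.count_lt_card hfin hi
  refine ⟨e, ⟨?_, ?_, ?_, ?_⟩, ?_⟩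
  · intro i hi; simp [e, hi]
  · intro i hi
    simp only [e]
    split_ifs with h1 h2
    · omega
    · have := hcnt i h2; omega
    · omega
  · intro i hi
    simp only [e]
    rw [if_neg (by omega), if_neg]
    intro h; have := hST i h; omega
  · intro v hv
    by_cases hva : v < a
    · refine ⟨v, by omega, by simp [e, hva], fun i hi => ?_⟩
      simp only [e]
      rw [if_pos (by omega)]; exact hi
    · have h1 : v - a < hfin.toFinset.card := by omega
      have hm : Nat.nth (· ∈ S) (v - a) ∈ S := Nat.nth_mem_of_lt_card hfin h1
      have hc : Nat.count (· ∈ S) (Nat.nth (· ∈ S) (v - a)) = v - a :=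
        Nat.count_nth_of_lt_card_finite hfin h1
      have hb := hST _ hm
      refine ⟨Nat.nth (· ∈ S) (v - a), hb.2, ?_, fun i hi => ?_⟩
      · simp only [e]
        rw [if_neg (by omega), if_pos hm, hc]; omega
      · simp only [e]
        split_ifs with h2 h3
        · omega
        · have := Nat.count_strict_mono (p := (· ∈ S)) h3 hi
          omega
        · omega
  · intro v p hv h
    have h1 := h.1
    by_contra hp
    simp only [e, hp, if_false] at h1
    split_ifs at h1 <;> omega

theorem gr_step (k a : ℕ) (ha : 1 ≤ a) (hak : a < k) (hP : GR k (a + 1)) : GR k a := by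
  classical
  intro m hm κ _
  obtain ⟨s, rfl⟩ := Nat.exists_eq_add_of_le hm
  have := Fintype.ofFinite κ
  let T := Fintype.card κ * s
  obtain ⟨n2, hn2, H2⟩ := blocks a ha T κ
  obtain ⟨n, hn, H⟩ := fusion k a ha hak hP (n2 - a) n2 (by omega) κ
  refine ⟨n, hn, fun c => ?_⟩
  have : Nonempty κ := ⟨c id⟩
  obtain ⟨g, hg, hc⟩ := H c
  let c' : ℕ → (ℕ → ℕ) → κ := fun p u =>
    if h : ∃ f, Wd a k n2 f ∧ FirstAt f a p ∧ ∀ i < p, f i = u i then c (h.choose ∘ g)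
    else c id
  have hc' : ∀ f p, Wd a k n2 f → FirstAt f a p → c' p (trunc p f) = c (f ∘ g) := by
    intro f p hf hp
    have hex : ∃ f', Wd a k n2 f' ∧ FirstAt f' a p ∧ ∀ i < p, f' i = trunc p f i :=
      ⟨f, hf, hp, fun i hi => by simp [trunc, hi]⟩
    have hsp := hex.choose_spec
    simp only [c']
    rw [dif_pos hex]
    have hpn : p < a + (n2 - a) := by
      by_contra hcon
      have := hf.zero p (by omega)
      have := hp.1
      omega
    refine hc _ f hsp.1 hf p hpn hsp.2.1 fun i hi => ?_
    rcases hi.lt_or_eq with h | h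
    · rw [hsp.2.2 i h]; simp [trunc, h]
    · rw [h, hsp.2.1.1, hp.1]
  obtain ⟨h, q, hW, hqn, hq, hcol⟩ := H2 c'
  let d : ℕ → κ := fun j => c' (q j) (trunc (q j) (trunc a id ∘ h))
  have x0 : ∀ j, a ≤ j → Wd a a j (trunc a id) := by
    intro j hj
    have h0 := wd_id (le_refl a)
    refine ⟨h0.fix, ?_, fun i hi => h0.zero i (by omega), ?_⟩
    · intro i hi
      by_cases h : i < a
      · simp [trunc, h]
      · simp [trunc, h]; omega
    · intro v hv
      obtain ⟨p, hp, h1⟩ := h0.first v hv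
      exact ⟨p, by omega, h1⟩
  obtain ⟨y, -, hy⟩ := Finset.exists_le_card_fiber_of_mul_le_card_of_maps_to
    (s := Finset.Ico a (a + T)) (t := (Finset.univ : Finset κ)) (f := d) (n := s)
    (fun _ _ => Finset.mem_univ _) Finset.univ_nonempty (by simp [T])
  obtain ⟨S, hSsub, hScard⟩ := Finset.exists_subset_card_eq hy
  have hS1 : ∀ i ∈ S, (a ≤ i ∧ i < a + T) ∧ d i = y := by
    intro i hi
    simpa using hSsub hi
  obtain ⟨e, he, heS⟩ := select a s T ha S hScard (fun i hi => (hS1 i hi).1)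
  refine ⟨e ∘ h ∘ g, he.comp ha (hW.comp ha hg), ?_⟩
  have main : ∀ f, Wd a k (a + s) f → c (f ∘ e ∘ h ∘ g) = y := by
    intro f hf
    obtain ⟨p, hp, hfp⟩ := hf.first a hak
    have hpa := hfp.ge hf le_rfl
    obtain ⟨j, hj, hej⟩ := he.first p hp
    have hjS := heS p j hpa hej
    obtain ⟨⟨hj1, hj2⟩, hdj⟩ := hS1 j hjS
    obtain ⟨hqj, hhj⟩ := hq j hj1 hj2
    have hfe := hf.comp ha he
    have hfej := hfp.comp hej
    have hfeh := hfe.comp ha hW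
    have hfehj := hfej.comp hhj
    have e1 := hc' _ _ hfeh hfehj
    have hx : Wd a a j (trunc j (f ∘ e)) := by
      refine ⟨?_, ?_, ?_, ?_⟩
      · intro i hi; simp only [trunc]; rw [if_pos (by omega), hfe.fix i hi]
      · intro i hi; simp only [trunc, hi, if_true]; exact hfej.2 i hi
      · intro i hi; simp only [trunc]; rw [if_neg (by omega)]
      · intro v hv
        refine ⟨v, by omega, ?_, fun i hi => ?_⟩
        · simp only [trunc]; rw [if_pos (by omega), hfe.fix v hv]
        · simp only [trunc]; rw [if_pos (by omega), hfe.fix i (by omega)]; exact hi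
    have e2 := hcol j hj1 hj2.le _ _ hx (x0 j hj1)
    have e3 : trunc (q j) (trunc j (f ∘ e) ∘ h) = trunc (q j) ((f ∘ e) ∘ h) := by
      ext i
      simp only [trunc, Function.comp]
      split_ifs with h1 h2
      · rfl
      · exact absurd (hhj.2 i h1) h2
      · rfl
    rw [e3, e1] at e2
    exact e2.trans hdj
  intro f f' hf hf'
  rw [main f hf, main f' hf']

theorem gr (k : ℕ) (hk : 1 ≤ k) : GR k 1 := by
  have : ∀ t, t < k → GR k (k - t) := by
    intro t
    induction t with
    | zero => intro _; exact gr_base k hk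
    | succ t ih =>
      intro ht
      refine gr_step k _ (by omega) (by omega) ?_
      have := ih (by omega)
      rwa [show k - (t + 1) + 1 = k - t by omega]
  have h := this (k - 1) (by omega)
  rwa [show k - (k - 1) = 1 by omega] at h

theorem sort_surj (m n : ℕ) (hn : 1 ≤ n) (s : Fin m → Fin n) (hs : Function.Surjective s) :
    ∃ (σ : Equiv.Perm (Fin n)) (φ : ℕ → ℕ), Wd 1 n m φ ∧
      ∀ (i : Fin m) (h : φ i < n), s i = σ ⟨φ i, h⟩ := by
  classical
  have hex : ∀ v : Fin n, ∃ p : Fin m, s p = v ∧ ∀ i, s i = v → p ≤ i := by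
    intro v
    obtain ⟨i, hi⟩ := hs v
    have hne : (Finset.univ.filter (fun i => s i = v)).Nonempty := ⟨i, by simp [hi]⟩
    refine ⟨_, (Finset.mem_filter.1 (Finset.min'_mem _ hne)).2, fun j hj => ?_⟩
    exact Finset.min'_le _ _ (by simp [hj])
  choose p hp1 hp2 using hex
  let σ := Tuple.sort p
  have hmono : Monotone (p ∘ σ) := Tuple.monotone_sort p
  have hinj : Function.Injective p := Function.LeftInverse.injective hp1
  have hm : 0 < m := (p ⟨0, hn⟩).pos
  have key : ∀ (i : Fin m) (v : Fin n), i < p (σ v) → σ.symm (s i) < v := by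
    intro i v h
    by_contra hcon
    have h1 := hmono (not_lt.1 hcon)
    simp only [Function.comp, Equiv.apply_symm_apply] at h1
    exact absurd (lt_of_lt_of_le h h1) (not_lt.2 (hp2 _ i rfl))
  let φ : ℕ → ℕ := fun i => if h : i < m then (σ.symm (s ⟨i, h⟩) : ℕ) else 0
  refine ⟨σ, φ, ⟨?_, ?_, ?_, ?_⟩, ?_⟩
  · intro i hi
    have : i = 0 := by omega
    subst this
    simp only [φ, hm, dif_pos]
    have h1 : p (s ⟨0, hm⟩) ≤ ⟨0, hm⟩ := hp2 _ _ rfl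
    have h2 : p (s ⟨0, hm⟩) ≤ p (σ ⟨0, hn⟩) := h1.trans (by simp [Fin.le_def])
    by_contra hcon
    have h3 : (⟨0, hn⟩ : Fin n) ≤ σ.symm (s ⟨0, hm⟩) := by simp [Fin.le_def]
    have h4 := hmono h3
    simp only [Function.comp, Equiv.apply_symm_apply] at h4
    have h5 := hinj (le_antisymm h2 h4)
    rw [h5] at hcon
    simp at hcon
  · intro i hi; simp [φ, hi]
  · intro i hi; simp [φ]; omega
  · intro v hv
    refine ⟨p (σ ⟨v, hv⟩), (p _).2, ?_, fun i hi => ?_⟩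
    · simp [φ, hp1]
    · have him : i < m := hi.trans (p _).2
      have := key ⟨i, him⟩ ⟨v, hv⟩ hi
      simp only [φ, him, dif_pos]
      exact this
  · intro i h
    have : (⟨φ i, h⟩ : Fin n) = σ.symm (s i) := by ext; simp [φ]
    rw [this]; simp

/-- The space with all nonzero distances equal to `D`. -/
@[reducible] noncomputable def discMetric (C : Type) [DecidableEq C] (D : ℝ) (hD : 0 < D) :
    MetricSpace C where
  dist x y := if x = y then 0 else D
  dist_self x := by simp
  dist_comm x y := by simp [eq_comm]
  dist_triangle x y z := by
    by_cases h1 : x = y <;> by_cases h2 : y = z <;> by_cases h3 : x = z <;> simp_all <;> linarith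
  eq_of_dist_eq_zero {x y} h := by
    by_contra hne
    simp [hne] at h
    linarith

/-- The dual small Ramsey degree of a finite metric space `M` with `n` points,
with respect to non-expansive surjections, is at most `n!`. -/
theorem stmt_0 (M : Type) [MetricSpace M] [Fintype M] [Nonempty M]
    (n : ℕ) (hn : Fintype.card M = n) (k : ℕ) (hk : 1 ≤ k)
    (B : Type) [MetricSpace B] [Fintype B] [Nonempty B] :
    ∃ (C : Type) (mC : MetricSpace C), Finite C ∧ Nonempty C ∧
      @DualArrow C M B mC _ _ k (Nat.factorial n) := by
  classical
  have hn1 : 1 ≤ n := by rw [← hn]; exact Fintype.card_pos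
  have hm1 : 1 ≤ Fintype.card B := Fintype.card_pos
  obtain ⟨N, hN, H⟩ := gr n hn1 (Fintype.card B) hm1 (Equiv.Perm (Fin n) → Fin k)
  let D : ℝ := Metric.diam (Set.univ : Set M) + Metric.diam (Set.univ : Set B) + 1
  have hdM : 0 ≤ Metric.diam (Set.univ : Set M) := Metric.diam_nonneg
  have hdB : 0 ≤ Metric.diam (Set.univ : Set B) := Metric.diam_nonneg
  have hD : 0 < D := by simp only [D]; linarith
  letI mC : MetricSpace (Fin N) := discMetric (Fin N) D hD
  have hdist : ∀ x y : Fin N, x ≠ y → dist x y = D := fun x y h => if_neg h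
  have neM : ∀ f : Fin N → M, Function.Surjective f → IsNESurj f := by
    refine fun f hf => ⟨hf, fun x y => ?_⟩
    by_cases h : x = y
    · simp [h]
    · rw [hdist x y h]
      have := Metric.dist_le_diam_of_mem (Set.finite_univ (α := M)).isBounded
        (Set.mem_univ (f x)) (Set.mem_univ (f y))
      simp only [D]; linarith
  have neB : ∀ f : Fin N → B, Function.Surjective f → IsNESurj f := by
    refine fun f hf => ⟨hf, fun x y => ?_⟩
    by_cases h : x = y
    · simp [h]
    · rw [hdist x y h]
      have := Metric.dist_le_diam_of_mem (Set.finite_univ (α := B)).isBounded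
        (Set.mem_univ (f x)) (Set.mem_univ (f y))
      simp only [D]; linarith
  refine ⟨Fin N, mC, inferInstance, ⟨⟨0, hN⟩⟩, ?_⟩
  intro χ
  let eB : B ≃ Fin (Fintype.card B) := Fintype.equivFin B
  let eM : M ≃ Fin n := Fintype.equivFinOfCardEq hn
  let G : (ℕ → ℕ) → Equiv.Perm (Fin n) → Fin N → M :=
    fun z σ i => eM.symm (σ ⟨z i % n, Nat.mod_lt _ hn1⟩)
  let c : (ℕ → ℕ) → Equiv.Perm (Fin n) → Fin k :=
    fun z σ => if h : IsNESurj (G z σ) then χ ⟨_, h⟩ else ⟨0, hk⟩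
  obtain ⟨g, hg, hc⟩ := H c
  let w : Fin N → B := fun i => eB.symm ⟨g i, hg.lt i i.2⟩
  have hw : Function.Surjective w := by
    intro b
    obtain ⟨p, hp, h1, -⟩ := hg.first (eB b) (eB b).2
    refine ⟨⟨p, hp⟩, ?_⟩
    simp [w, h1]
  refine ⟨w, neB w hw, ?_⟩
  have key : ∀ f : B → M, Function.Surjective f → ∃ (σ : Equiv.Perm (Fin n)) (φ : ℕ → ℕ),
      Wd 1 n (Fintype.card B) φ ∧ f ∘ w = G (φ ∘ g) σ := by
    intro f hf
    obtain ⟨σ, φ, hφ, hs⟩ := sort_surj (Fintype.card B) n hn1 (fun i => eM (f (eB.symm i)))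
      (eM.surjective.comp (hf.comp eB.symm.surjective))
    refine ⟨σ, φ, hφ, ?_⟩
    ext i
    have h1 := hφ.lt _ (hg.lt i i.2)
    have h2 := hs ⟨g i, hg.lt i i.2⟩ h1
    simp only [G, Function.comp, Nat.mod_eq_of_lt h1, w]
    rw [← h2]
    simp
  by_cases hex : ∃ f0 : B → M, Function.Surjective f0
  · obtain ⟨f0, hf0⟩ := hex
    obtain ⟨-, φ0, hφ0, -⟩ := key f0 hf0
    have hsub : {c : Fin k | ∃ g : {f : Fin N → M // IsNESurj f},
        (∃ f : B → M, IsNESurj f ∧ g.1 = f ∘ w) ∧ χ g = c} ⊆ Set.range (c (φ0 ∘ g)) := by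
      rintro _ ⟨⟨u, hu⟩, ⟨f, hf, hfu⟩, rfl⟩
      obtain ⟨σ, φ, hφ, hG⟩ := key f hf.1
      refine ⟨σ, ?_⟩
      rw [hc φ0 φ hφ0 hφ]
      have hu' : u = G (φ ∘ g) σ := by rw [← hG]; exact hfu
      subst hu'
      simp only [c]
      rw [dif_pos hu]
    refine (Set.ncard_le_ncard hsub (Set.toFinite _)).trans ?_
    rw [← Set.image_univ]
    refine (Set.ncard_image_le (Set.toFinite _)).trans ?_
    rw [Set.ncard_univ, Nat.card_eq_fintype_card, Fintype.card_perm, Fintype.card_fin]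
  · have : {c : Fin k | ∃ g : {f : Fin N → M // IsNESurj f},
        (∃ f : B → M, IsNESurj f ∧ g.1 = f ∘ w) ∧ χ g = c} = ∅ := by
      ext c
      simp only [Set.mem_setOf_eq, Set.mem_empty_iff_false, iff_false]
      rintro ⟨_, ⟨f, hf, _⟩, _⟩
      exact hex ⟨f, hf.1⟩
    rw [this]
    simp
end

section
/- Let (M, d, <) be a finite nonempty linearly ordered metric space and let H denote the set of all maps ℕ → M that are simultaneously non-expansive surjections from Ω onto (M, d) and rigid surjections from (ℕ, ≤) onto (M, <). Then for every k ≥ 1 and every coloring χ : H → Fin k each of whose color classes is a Borel subset of the product space M^ℕ (M taken discrete, M^ℕ with the product topology), there exists a map w : ℕ → ℕ that is simultaneously a non-expansive surjection Ω → Ω and a rigid surjection (ℕ, ≤) → (ℕ, ≤), such that χ(f ∘ w) takes the same value for all f ∈ H. (The dual big Ramsey degree of every finite linearly ordered metric space in Ω^< with respect to non-expansive rigid surjections and Borel colorings equals 1.) -/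
/-- A non-expansive surjection from `Ω = (ℕ, d_ω)` (where `d_ω(x,y) = max{x,y}`
for `x ≠ y`) onto a metric space `M`. -/
def IsOmegaNESurj {M : Type*} [MetricSpace M] (f : ℕ → M) : Prop :=
  Function.Surjective f ∧ ∀ x y : ℕ, x ≠ y → dist (f x) (f y) ≤ ((max x y : ℕ) : ℝ)

/-- A non-expansive surjection `Ω → Ω`. -/
def IsOmegaNESurjSelf (w : ℕ → ℕ) : Prop :=
  Function.Surjective w ∧ ∀ x y : ℕ, w x ≠ w y → max (w x) (w y) ≤ max x y

/-- A rigid surjection from `(ℕ, ≤)` onto a linearly ordered set `(M, <)`. -/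
def IsRigidSurj {M : Type*} [LinearOrder M] (f : ℕ → M) : Prop :=
  Function.Surjective f ∧
    ∀ b₁ b₂ : M, b₁ < b₂ → sInf {x : ℕ | f x = b₁} < sInf {x : ℕ | f x = b₂}

section CSUltra

open Filter

attribute [local instance] Ultrafilter.mul Ultrafilter.semigroup

theorem exists_min_closed_left_ideal {S : Type*} [Semigroup S] [Nonempty S]
    [TopologicalSpace S] [CompactSpace S] :
    ∃ N : Set S, Minimal (· ∈ {N : Set S | IsClosed N ∧ N.Nonempty ∧ ∀ s, ∀ x ∈ N, s * x ∈ N}) N := by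
  refine zorn_superset _ fun c hcs hc => ?_
  refine
    ⟨⋂₀ c, ⟨isClosed_sInter fun t ht => (hcs ht).1, ?_, fun m m' hm' => ?_⟩, fun s hs =>
      Set.sInter_subset_of_mem hs⟩
  · obtain rfl | hcnemp := c.eq_empty_or_nonempty
    · rw [Set.sInter_empty]
      apply Set.univ_nonempty
    convert!
      @IsCompact.nonempty_iInter_of_directed_nonempty_isCompact_isClosed _ _ _ hcnemp.coe_sort
        ((↑) : c → Set S) ?_ ?_ ?_ ?_
    · exact Set.sInter_eq_iInter
    · refine DirectedOn.directed_val (IsChain.directedOn hc.symm)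
    exacts [fun i => (hcs i.prop).2.1, fun i => (hcs i.prop).1.isCompact, fun i => (hcs i.prop).1]
  · rw [Set.mem_sInter]
    exact fun t ht => (hcs ht).2.2 m m' (Set.mem_sInter.mp hm' t ht)

theorem ultra_map_mul {X Y : Type*} [Semigroup X] [Semigroup Y] (φ : X →ₙ* Y)
    (p q : Ultrafilter X) : (p * q).map φ = p.map φ * q.map φ := by
  apply Ultrafilter.coe_inj.mp
  apply Filter.ext'
  intro P
  rw [Ultrafilter.eventually_mul]
  simp only [Ultrafilter.coe_map, Filter.eventually_map, Ultrafilter.eventually_mul, map_mul]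

theorem cs_ultra {A κ : Type*} [Finite A] [Nonempty A] [Finite κ] (C : List A → κ) :
    ∃ c0, ∃ B : Set (List A), (∀ z ∈ B, C z = c0) ∧ B.Nonempty ∧
      ∃ q : Ultrafilter (List (Option A)), ∀ z ∈ B, ∀ᶠ v in (q : Filter (List (Option A))),
        (∃ v', v = none :: v') ∧ ∀ a, z ++ v.map (fun o => o.getD a) ∈ B := by
  classical
  obtain ⟨Λ, hΛ⟩ := exists_min_closed_left_ideal (S := Ultrafilter (FreeMonoid A))
  obtain ⟨hΛc, ⟨p, hp⟩, hΛm⟩ := hΛ.prop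
  let ι : FreeMonoid A →ₙ* FreeMonoid (Option A) := (FreeMonoid.map some : FreeMonoid A →* _)
  let σ : A → FreeMonoid (Option A) →ₙ* FreeMonoid A :=
    fun a => (FreeMonoid.map (fun o : Option A => o.getD a) : FreeMonoid (Option A) →* _)
  have hσι : ∀ a, (p.map ι).map (σ a) = p := by
    intro a
    rw [Ultrafilter.map_map]
    convert! Ultrafilter.map_id p
    funext x
    change FreeMonoid.map (fun o : Option A => o.getD a) (FreeMonoid.map some x) = x
    change FreeMonoid.ofList (List.map _ (List.map _ x.toList)) = x
    rw [List.map_map]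
    exact List.map_id _
  let LV : Set (FreeMonoid (Option A)) := {v | ∃ v', v = FreeMonoid.of none * v'}
  let N : Set (Ultrafilter (FreeMonoid (Option A))) :=
    Set.range (fun t => t * p.map ι) ∩ {t | LV ∈ t}
  have hNc : IsCompact N := by
    apply IsCompact.inter_right
    · exact isCompact_range (Ultrafilter.continuous_mul_left _)
    · exact ultrafilter_isClosed_basic _
  have hLV : ∀ s t : Ultrafilter (FreeMonoid (Option A)), LV ∈ s → LV ∈ s * t := by
    intro s t hs
    change ∀ᶠ m in (s * t : Ultrafilter _), m ∈ LV
    rw [Ultrafilter.eventually_mul]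
    have hs' : ∀ᶠ m in (s : Filter _), m ∈ LV := hs
    filter_upwards [hs'] with m hm
    refine Eventually.of_forall fun m' => ?_
    obtain ⟨v, rfl⟩ := hm
    exact ⟨v * m', by rw [mul_assoc]⟩
  have hNn : N.Nonempty := by
    refine ⟨_, ⟨pure (FreeMonoid.of none), rfl⟩, ?_⟩
    change LV ∈ (pure (FreeMonoid.of none) * p.map ι : Ultrafilter _)
    apply hLV
    exact ⟨1, by simp⟩
  obtain ⟨q, ⟨⟨t, ht⟩, hqL⟩, hqi⟩ := exists_idempotent_in_compact_subsemigroup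
    (fun r => Ultrafilter.continuous_mul_left r) N hNn hNc (by
      rintro x ⟨⟨x', rfl⟩, hx⟩ y ⟨⟨y', rfl⟩, hy⟩
      refine ⟨⟨x' * p.map ι * y', ?_⟩, ?_⟩
      · simp only [mul_assoc]
      · change LV ∈ ((x' * p.map ι) * (y' * p.map ι) : Ultrafilter _)
        exact hLV _ _ hx)
  have hrΛ : ∀ a, q.map (σ a) ∈ Λ := by
    intro a
    rw [← ht, ultra_map_mul, hσι]
    exact hΛm _ _ hp
  have habs : ∀ a, ∀ x ∈ Λ, x * q.map (σ a) = x := by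
    intro a x hx
    have hsub : Set.range (fun s => s * q.map (σ a)) = Λ := by
      apply hΛ.eq_of_subset
      · refine ⟨(isCompact_range (Ultrafilter.continuous_mul_left _)).isClosed,
          Set.range_nonempty _, ?_⟩
        rintro s _ ⟨y, rfl⟩
        exact ⟨s * y, mul_assoc _ _ _⟩
      · rintro _ ⟨y, rfl⟩
        exact hΛm _ _ (hrΛ a)
    rw [← hsub] at hx
    obtain ⟨s, rfl⟩ := hx
    simp only [mul_assoc]
    rw [← ultra_map_mul, hqi]
  obtain ⟨a0⟩ := ‹Nonempty A›
  set r := q.map (σ a0) with hr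
  obtain ⟨c0, hc0⟩ := Ultrafilter.eq_pure_of_finite (r.map (fun z : FreeMonoid A => C z.toList))
  have hrc : ∀ᶠ z in (r : Filter (FreeMonoid A)), C z.toList = c0 := by
    have : ∀ᶠ c in (r.map (fun z : FreeMonoid A => C z.toList) : Filter κ), c = c0 := by
      rw [hc0]; simp
    simpa using this
  have key : ∀ (P : FreeMonoid A → Prop) a, ∀ x ∈ Λ, (∀ᶠ z in (x : Filter (FreeMonoid A)), P z) →
      ∀ᶠ z in (x : Filter (FreeMonoid A)), ∀ᶠ v in (q : Filter (FreeMonoid (Option A))),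
        P (z * σ a v) := by
    intro P a x hx h
    rw [← habs a x hx, Ultrafilter.eventually_mul] at h
    simpa using h
  let B : Set (FreeMonoid A) := {z | C z.toList = c0 ∧
    ∀ a, ∀ᶠ v in (q : Filter (FreeMonoid (Option A))), C (z * σ a v).toList = c0}
  have hB : B ∈ r := by
    have h2 : ∀ᶠ z in (r : Filter (FreeMonoid A)), ∀ a,
      ∀ᶠ v in (q : Filter (FreeMonoid (Option A))), C (z * σ a v).toList = c0 := by
      rw [eventually_all]
      intro a
      exact key _ a r (hrΛ a0) hrc
    filter_upwards [hrc, h2] with z h1 h2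
    exact ⟨h1, h2⟩
  refine ⟨c0, B, fun z hz => hz.1, Ultrafilter.nonempty_of_mem hB, q, ?_⟩
  intro z hz
  have h1 : ∀ᶠ v in (q : Filter (FreeMonoid (Option A))), v ∈ LV := hqL
  have h2 : ∀ᶠ v in (q : Filter (FreeMonoid (Option A))), ∀ a,
      C (FreeMonoid.toList (FreeMonoid.ofList z * σ a v)) = c0 := by
    rw [eventually_all]
    exact hz.2
  have h3 : ∀ᶠ v in (q : Filter (FreeMonoid (Option A))), ∀ a b,
      ∀ᶠ v' in (q : Filter (FreeMonoid (Option A))),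
      C (FreeMonoid.toList (FreeMonoid.ofList z * σ a v * σ b v')) = c0 := by
    rw [eventually_all]
    intro a
    rw [eventually_all]
    intro b
    have h4 : ∀ᶠ y in (q.map (σ a) : Filter (FreeMonoid A)),
      C (FreeMonoid.toList (FreeMonoid.ofList z * y)) = c0 := hz.2 a
    have h5 := key _ b _ (hrΛ a) h4
    simp only [← mul_assoc] at h5
    exact h5
  have h6 : ∀ᶠ v in (q : Filter (FreeMonoid (Option A))), (∃ v' : List (Option A),
      v = FreeMonoid.ofList (none :: v')) ∧
      ∀ a, FreeMonoid.ofList z * σ a v ∈ B := by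
    filter_upwards [h1, h2, h3] with v h1 h2 h3
    refine ⟨?_, fun a => ⟨h2 a, fun b => h3 a b⟩⟩
    obtain ⟨v', rfl⟩ := h1
    exact ⟨v'.toList, rfl⟩
  exact h6

end CSUltra

/-! ### Rigid surjections of `ℕ` -/

def Rig (w : ℕ → ℕ) : Prop :=
  Function.Surjective w ∧ ∀ x b, b < w x → ∃ y < x, w y = b

noncomputable def Fst (w : ℕ → ℕ) (m : ℕ) : ℕ := sInf {x | w x = m}

def tr {α : Type*} (f : ℕ → α) (n : ℕ) : List α := (List.range n).map f

theorem tr_congr {α : Type*} {f g : ℕ → α} {n : ℕ} (h : ∀ x < n, f x = g x) : tr f n = tr g n := by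
  unfold tr
  apply List.map_congr_left
  intro x hx
  exact h x (List.mem_range.1 hx)

theorem tr_length {α : Type*} (f : ℕ → α) (n : ℕ) : (tr f n).length = n := by simp [tr]

theorem tr_map {α β : Type*} (f : ℕ → α) (g : α → β) (n : ℕ) : (tr f n).map g = tr (g ∘ f) n := by
  simp [tr]

theorem tr_getElem {α : Type*} (f : ℕ → α) (n : ℕ) (x : ℕ) (hx : x < (tr f n).length) :
    (tr f n)[x] = f x := by simp [tr]

theorem rig_id : Rig id := ⟨Function.surjective_id, fun _ b h => ⟨b, h, rfl⟩⟩

theorem Rig.comp {W w : ℕ → ℕ} (hW : Rig W) (hw : Rig w) : Rig (W ∘ w) := by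
  refine ⟨hW.1.comp hw.1, ?_⟩
  intro x b h
  obtain ⟨y, hy, rfl⟩ := hW.2 _ _ h
  obtain ⟨z, hz, rfl⟩ := hw.2 _ _ hy
  exact ⟨z, hz, rfl⟩

theorem Rig.le {w : ℕ → ℕ} (hw : Rig w) (x : ℕ) : w x ≤ x := by
  induction x using Nat.strong_induction_on with
  | _ x ih =>
    by_contra h
    push Not at h
    obtain ⟨y, hy, hyx⟩ := hw.2 _ _ h
    have := ih y hy
    omega

theorem Rig.fst {w : ℕ → ℕ} (hw : Rig w) (m : ℕ) : w (Fst w m) = m := by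
  have : (sInf {x | w x = m}) ∈ {x | w x = m} := Nat.sInf_mem (hw.1 m)
  exact this

theorem Rig.lt_of_lt {w : ℕ → ℕ} (hw : Rig w) {m x : ℕ} (h : x < Fst w m) : w x < m := by
  by_contra hc
  push Not at hc
  rcases hc.eq_or_lt with h1 | h1
  · exact Nat.notMem_of_lt_sInf h h1.symm
  · obtain ⟨y, hy, hyx⟩ := hw.2 _ _ h1
    exact Nat.notMem_of_lt_sInf (hy.trans h) hyx

theorem Rig.le_fst {w : ℕ → ℕ} (hw : Rig w) (m : ℕ) : m ≤ Fst w m := by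
  have := hw.le (Fst w m)
  rwa [hw.fst] at this

theorem Fst_eq {w : ℕ → ℕ} {m x : ℕ} (h : w x = m) (h' : ∀ y < x, w y ≠ m) : Fst w m = x := by
  apply le_antisymm
  · exact Nat.sInf_le h
  · by_contra hc
    push Not at hc
    have : (sInf {x | w x = m}) ∈ {x | w x = m} := Nat.sInf_mem ⟨x, h⟩
    exact h' _ hc this

theorem Rig.fst_comp {W w : ℕ → ℕ} (hW : Rig W) (hw : Rig w) (m : ℕ) :
    Fst (W ∘ w) m = Fst w (Fst W m) := by
  apply Fst_eq
  · simp [hw.fst, hW.fst]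
  · intro y hy
    have := hw.lt_of_lt hy
    exact (hW.lt_of_lt this).ne

theorem Rig.fst_mono {w : ℕ → ℕ} (hw : Rig w) {a b : ℕ} (h : a < b) : Fst w a < Fst w b := by
  by_contra hc
  push Not at hc
  rcases hc.eq_or_lt with h1 | h1
  · have := congrArg w h1
    rw [hw.fst, hw.fst] at this
    omega
  · have := hw.lt_of_lt h1
    rw [hw.fst] at this
    omega

theorem build (m : ℕ) (Q : ℕ → List ℕ → Prop)
    (h0 : ∃ l, (∀ x ∈ l, x ≤ m) ∧ Q 0 l)
    (hs : ∀ i l, Q i l → ∃ t, (∀ x ∈ t, x ≤ m + i + 1) ∧ Q (i + 1) (l ++ (m + i + 1) :: t)) :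
    ∃ W, Rig W ∧ (∀ i ≤ m, W i = i) ∧
      ∀ i, ∃ l, Q i l ∧ tr W (Fst W (m + 1 + i)) = List.range (m + 1) ++ l := by
  obtain ⟨l0, hl0, hQ0⟩ := h0
  choose t ht hQt using hs
  let L : (i : ℕ) → {l // Q i l} := fun i => Nat.rec (motive := fun i => {l // Q i l})
    ⟨l0, hQ0⟩ (fun i l => ⟨l.1 ++ (m + i + 1) :: t i l.1 l.2, hQt i l.1 l.2⟩) i
  let pre : ℕ → List ℕ := fun i => List.range (m + 1) ++ (L i).1
  let T : ℕ → List ℕ := fun i => t i (L i).1 (L i).2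
  have hT : ∀ i, ∀ x ∈ T i, x ≤ m + i + 1 := fun i => ht i _ _
  have pre_succ : ∀ i, pre (i + 1) = pre i ++ (m + i + 1) :: T i := by
    intro i
    simp only [pre, T, List.append_assoc]
    rfl
  have pre_zero : pre 0 = List.range (m + 1) ++ l0 := rfl
  have pre_le : ∀ i j, i ≤ j → pre i <+: pre j := by
    intro i j h
    induction h with
    | refl => exact List.prefix_refl _
    | step _ ih => 
      refine ih.trans ?_
      rw [Nat.succ_eq_add_one, pre_succ]
      exact List.prefix_append _ _
  have len : ∀ i, m + 1 + i ≤ (pre i).length := by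
    intro i
    induction i with
    | zero => rw [pre_zero]; simp
    | succ i ih => rw [pre_succ]; simp; omega
  have hpre : ∀ i, ∃ l, Q i l ∧ pre i = List.range (m + 1) ++ l :=
    fun i => ⟨(L i).1, (L i).2, rfl⟩
  clear_value pre T
  let W : ℕ → ℕ := fun x => (pre (x + 1)).getD x 0
  have hW : ∀ i x (hx : x < (pre i).length), W x = (pre i)[x] := by
    intro i x hx
    have hx' : x < (pre (x + 1)).length := by have := len (x + 1); omega
    have h1 : W x = (pre (x + 1))[x] := by simp [W, hx']
    rw [h1]
    rcases le_total i (x + 1) with h | h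
    · exact ((pre_le _ _ h).getElem hx).symm
    · exact (pre_le _ _ h).getElem hx'
  have hle : ∀ i, ∀ x ∈ pre i, x ≤ m + i := by
    intro i
    induction i with
    | zero =>
      rw [pre_zero]
      intro x hx
      rcases List.mem_append.1 hx with h | h
      · have := List.mem_range.1 h; omega
      · exact hl0 x h
    | succ i ih =>
      rw [pre_succ]
      intro x hx
      rcases List.mem_append.1 hx with h | h
      · have := ih x h; omega
      · rcases List.mem_cons.1 h with h | h
        · omega
        · exact hT i x h
  have hmem : ∀ i b, b ≤ m + i → b ∈ pre i := by
    intro i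
    induction i with
    | zero =>
      intro b hb
      rw [pre_zero]
      exact List.mem_append_left _ (List.mem_range.2 (by omega))
    | succ i ih =>
      intro b hb
      rw [pre_succ]
      rcases Nat.lt_or_ge (m + i) b with h | h
      · have : b = m + i + 1 := by omega
        simp [this]
      · exact List.mem_append_left _ (ih b h)
  have hWfix : ∀ i ≤ m, W i = i := by
    intro i hi
    have h1 : i < (pre 0).length := by have := len 0; omega
    rw [hW 0 i h1]
    simp only [pre_zero]
    rw [List.getElem_append_left (by simp; omega)]
    simp
  have hWlen : ∀ i, W (pre i).length = m + i + 1 := by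
    intro i
    rw [hW (i + 1) _ (by rw [pre_succ]; simp)]
    simp [pre_succ]
  have hWle : ∀ i, ∀ x < (pre i).length, W x ≤ m + i := by
    intro i x hx
    rw [hW i x hx]
    exact hle i _ (List.getElem_mem _)
  have hFst : ∀ i, Fst W (m + 1 + i) = (pre i).length := by
    intro i
    apply Fst_eq
    · rw [hWlen]; omega
    · intro y hy
      have := hWle i y hy
      omega
  refine ⟨W, ⟨?_, ?_⟩, hWfix, ?_⟩
  · intro b
    rcases Nat.lt_or_ge m b with h | h
    · obtain ⟨i, rfl⟩ := Nat.exists_eq_add_of_lt h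
      exact ⟨_, hWlen i⟩
    · exact ⟨b, hWfix b h⟩
  · intro x
    have hx : x < (pre x).length := by have := len x; omega
    generalize hi : x = i at hx
    have : ∀ i, ∀ x < (pre i).length, ∀ b < W x, ∃ y < x, W y = b := by
      intro i
      induction i with
      | zero =>
        intro x hx b hb
        have h1 := hWle 0 x hx
        rcases Nat.lt_or_ge m x with h | h
        · exact ⟨b, by omega, hWfix b (by omega)⟩
        · rw [hWfix x h] at hb
          exact ⟨b, hb, hWfix b (by omega)⟩
      | succ i ih =>
        intro x hx b hb
        rcases Nat.lt_or_ge x (pre i).length with h | h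
        · exact ih x h b hb
        · have h1 := hWle _ x hx
          have h2 := hmem i b (by omega)
          obtain ⟨y, hy, rfl⟩ := List.getElem_of_mem h2
          exact ⟨y, by omega, hW i y hy⟩
    exact this i i (by subst hi; exact hx)
  · intro i
    obtain ⟨l, hl, hl'⟩ := hpre i
    refine ⟨l, hl, ?_⟩
    rw [hFst, ← hl']
    apply List.ext_getElem
    · simp [tr_length]
    · intro x h1 h2
      rw [tr_getElem]
      exact hW i x h2

theorem fusion_s4 (Φ : ℕ → (ℕ → ℕ) → Prop)
    (hered : ∀ m w W, Rig w → Rig W → (∀ i ≤ m, W i = i) → Φ m w → Φ m (W ∘ w))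
    (step : ∀ m w, Rig w → ∃ W, Rig W ∧ (∀ i ≤ m, W i = i) ∧ Φ m (W ∘ w)) :
    ∃ w, Rig w ∧ ∀ m, Φ m w := by
  choose! V hV hVfix hVΦ using step
  let w : ℕ → (ℕ → ℕ) := fun m => Nat.rec id (fun m w => V m w ∘ w) m
  have w_succ : ∀ m, w (m + 1) = V m (w m) ∘ w m := fun m => rfl
  have hw : ∀ m, Rig (w m) := by
    intro m
    induction m with
    | zero => exact rig_id
    | succ m ih => rw [w_succ]; exact (hV _ _ ih).comp ih
  have hΦ : ∀ m, Φ m (w (m + 1)) := fun m => by rw [w_succ]; exact hVΦ _ _ (hw m)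
  -- tails
  let z : ℕ → ℕ → (ℕ → ℕ) := fun m d => Nat.rec id (fun d z => V (m + d) (w (m + d)) ∘ z) d
  have z_succ : ∀ m d, z m (d + 1) = V (m + d) (w (m + d)) ∘ z m d := fun m d => rfl
  have hz : ∀ m d, Rig (z m d) := by
    intro m d
    induction d with
    | zero => exact rig_id
    | succ d ih => rw [z_succ]; exact (hV _ _ (hw _)).comp ih
  have hzw : ∀ m d, w (m + d) = z m d ∘ w m := by
    intro m d
    induction d with
    | zero => rfl
    | succ d ih => rw [← Nat.add_assoc, w_succ, z_succ, ih]; rfl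
  have hzst : ∀ m x d, x ≤ m + d → ∀ e, d ≤ e → z m e x = z m d x := by
    intro m x d hx e he
    induction he with
    | refl => rfl
    | step h ih =>
      rename_i e
      rw [Nat.succ_eq_add_one, z_succ, Function.comp, ih]
      apply hVfix _ _ (hw _)
      have := (hz m d).le x
      have : d ≤ e := h
      omega
  have hzfix : ∀ m d, ∀ x ≤ m, z m d x = x := by
    intro m d x hx
    rw [hzst m x 0 (by omega) d (by omega)]
    rfl
  let Z : ℕ → (ℕ → ℕ) := fun m x => z m x x
  have hZ : ∀ m x d, x ≤ d → z m d x = Z m x := by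
    intro m x d h
    exact hzst m x x (by omega) d h
  have hZrig : ∀ m, Rig (Z m) := by
    intro m
    constructor
    · intro b
      obtain ⟨x, hx⟩ := (hz m b).1 b
      refine ⟨x, ?_⟩
      rcases le_total x b with h | h
      · rw [← hZ m x b h, hx]
      · obtain ⟨x', hx'⟩ := (hz m x).1 b
        rw [← hZ m x x le_rfl, ← hx]
        -- `z m x x = z m b x` as the value stabilises
        have : ∀ e, b ≤ e → z m e x = b := by
          intro e he
          induction he with
          | refl => exact hx
          | step h ih =>
            rename_i e
            have : b ≤ e := h
            rw [Nat.succ_eq_add_one, z_succ, Function.comp, ih]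
            exact hVfix _ _ (hw _) _ (by omega)
        rw [this x h, hx]
    · intro x b hb
      obtain ⟨y, hy, hyb⟩ := (hz m x).2 x b hb
      exact ⟨y, hy, by rw [← hZ m y x hy.le, hyb]⟩
  refine ⟨Z 0, hZrig 0, fun m => ?_⟩
  have h1 : Z 0 = Z (m + 1) ∘ w (m + 1) := by
    funext x
    rw [Function.comp, ← hZ (m + 1) (w (m + 1) x) x ((hw (m + 1)).le x)]
    have h2 := congrFun (hzw (m + 1) x) x
    rw [Function.comp] at h2
    rw [← h2]
    have h3 := congrFun (hzw 0 (m + 1 + x)) x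
    rw [Nat.zero_add] at h3
    rw [h3, ← hZ 0 x (m + 1 + x) (by omega)]
    rfl
  rw [h1]
  refine hered m (w (m + 1)) (Z (m + 1)) (hw (m + 1)) (hZrig (m + 1)) ?_ (hΦ m)
  intro i hi
  exact hzfix _ _ _ (by omega)

theorem cs_stage {κ : Type*} [Finite κ] (C : List ℕ → κ) (m : ℕ) :
    ∃ W, Rig W ∧ (∀ i ≤ m, W i = i) ∧ ∃ c0, ∀ g : ℕ → ℕ, (∀ i ≤ m, g i = i) → (∀ x, g x ≤ m) →
      ∀ i, m < i → C (tr (g ∘ W) (Fst W i)) = c0 := by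
  obtain ⟨c0, B, hBC, ⟨z0, hz0⟩, q, hq⟩ :=
    cs_ultra (A := Fin (m + 1)) (fun z => C (List.range (m + 1) ++ z.map Fin.val))
  let Q : ℕ → List ℕ → Prop := fun _ l => ∀ g : ℕ → Fin (m + 1), (∀ a : Fin (m + 1), g a = a) →
    l.map g ∈ B
  obtain ⟨W, hW, hWfix, hWQ⟩ := build m Q
    (by
      refine ⟨z0.map Fin.val, ?_, ?_⟩
      · intro x hx
        obtain ⟨a, -, rfl⟩ := List.mem_map.1 hx
        have := a.2
        omega
      · intro g hg
        rw [List.map_map]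
        have : g ∘ Fin.val = id := funext hg
        rw [this, List.map_id]
        exact hz0)
    (by
      intro i l hl
      have hfin : {z : List (Fin (m + 1)) | z.length = l.length}.Finite :=
        List.finite_length_eq _ _
      have h1 : ∀ᶠ v in (q : Filter (List (Option (Fin (m + 1))))),
          ∀ z ∈ {z : List (Fin (m + 1)) | z.length = l.length}, z ∈ B →
            ((∃ v', v = none :: v') ∧ ∀ a, z ++ v.map (fun o => o.getD a) ∈ B) := by
        rw [Filter.eventually_all_finite hfin]
        intro z _
        by_cases hz : z ∈ B
        · filter_upwards [hq z hz] with v hv _ using hv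
        · exact Filter.Eventually.of_forall fun v h => absurd h hz
      obtain ⟨v, hv1, hv2⟩ := (h1.and (hq z0 hz0)).exists
      obtain ⟨⟨v', rfl⟩, -⟩ := hv2
      refine ⟨v'.map (fun o => o.elim (m + i + 1) Fin.val), ?_, ?_⟩
      · intro x hx
        obtain ⟨o, -, rfl⟩ := List.mem_map.1 hx
        cases o with
        | none => simp
        | some a => have := a.2; simp; omega
      · intro g hg
        have h2 := (hv1 (l.map g) (by simp) (hl g hg)).2 (g (m + i + 1))
        convert! h2 using 1
        rw [List.map_append, List.map_cons, List.map_map]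
        congr 1
        rw [List.map_cons]
        congr 1
        apply List.map_congr_left
        intro o _
        cases o with
        | none => simp
        | some a => simp [hg])
  refine ⟨W, hW, hWfix, c0, ?_⟩
  intro g hg hgm i hi
  obtain ⟨d, rfl⟩ := Nat.exists_eq_add_of_lt hi
  obtain ⟨l, hl, htr⟩ := hWQ d
  let g' : ℕ → Fin (m + 1) := fun x => ⟨g x, by have := hgm x; omega⟩
  have h1 := hBC _ (hl g' (fun a => by
    apply Fin.ext
    exact hg a (by have := a.2; omega)))
  rw [← h1, ← tr_map, show m + d + 1 = m + 1 + d by omega, htr, List.map_append, List.map_map]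
  congr 2
  conv_rhs => rw [← List.map_id (List.range (m + 1))]
  apply List.map_congr_left
  intro x hx
  have := List.mem_range.1 hx
  exact hg x (by omega)

def FW (j m : ℕ) (f : ℕ → ℕ) : Prop :=
  (∀ x < m, f x < j) ∧ (∀ b < j, ∃ x < m, f x = b) ∧ ∀ x < m, ∀ b < f x, ∃ y < x, f y = b

/-- The first occurrence of the last letter of a rigid word. -/
theorem FW.split {j m : ℕ} {f : ℕ → ℕ} (h : FW (j + 1) m f) :
    ∃ p < m, f p = j ∧ FW j p f := by
  classical
  obtain ⟨x, hx, hxj⟩ := h.2.1 j (by omega)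
  have hex : ∃ x, f x = j := ⟨x, hxj⟩
  have hpm : Nat.find hex < m := lt_of_le_of_lt (Nat.find_min' hex hxj) hx
  have hp := Nat.find_spec hex
  refine ⟨Nat.find hex, hpm, hp, ?_, ?_, ?_⟩
  · intro y hy
    have h1 := h.1 y (by omega)
    have h2 := Nat.find_min hex hy
    omega
  · intro b hb
    exact h.2.2 _ hpm b (by omega)
  · intro y hy
    exact h.2.2 y (by omega)

/-- A rigid word over `ℕ` composed with a rigid surjection is rigid. -/
theorem FW.comp {j m : ℕ} {f w : ℕ → ℕ} (h : FW j m f) (hw : Rig w) : FW j (Fst w m) (f ∘ w) := by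
  refine ⟨?_, ?_, ?_⟩
  · intro x hx
    exact h.1 _ (hw.lt_of_lt hx)
  · intro b hb
    obtain ⟨x, hx, rfl⟩ := h.2.1 b hb
    exact ⟨Fst w x, hw.fst_mono hx, by simp [hw.fst]⟩
  · intro x hx b hb
    obtain ⟨y, hy, rfl⟩ := h.2.2 _ (hw.lt_of_lt hx) b hb
    obtain ⟨z, hz, rfl⟩ := hw.2 _ _ hy
    exact ⟨z, hz, rfl⟩

/-- Retracting a word onto the positions up to the first occurrence `p` of the last letter. -/
theorem FW.retract {j p : ℕ} {f : ℕ → ℕ} (h : FW j p f) (hp : f p = j) :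
    ∃ g : ℕ → ℕ, (∀ i ≤ p, g i = i) ∧ (∀ x, g x ≤ p) ∧
      ∀ x, f x ≤ j → f (g x) = f x := by
  classical
  have hex : ∀ b, ∃ x, x ≤ p ∧ (b ≤ j → f x = b) := by
    intro b
    rcases lt_trichotomy b j with hb | hb | hb
    · obtain ⟨x, hx, hxb⟩ := h.2.1 b hb
      exact ⟨x, hx.le, fun _ => hxb⟩
    · exact ⟨p, le_rfl, fun _ => by omega⟩
    · exact ⟨p, le_rfl, fun _ => by omega⟩
  choose r hr1 hr2 using hex
  refine ⟨fun x => if x ≤ p then x else r (f x), ?_, ?_, ?_⟩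
  · intro i hi; simp [hi]
  · intro x
    dsimp only
    split_ifs with h1
    · exact h1
    · exact hr1 _
  · intro x hx
    dsimp only
    split_ifs with h1
    · rfl
    · exact hr2 _ hx

theorem finite_ramsey {κ : Type*} [Finite κ] (j : ℕ) : ∀ c : List ℕ → κ,
    ∃ w, Rig w ∧ ∃ c0, ∀ m f, FW j m f → c (tr (f ∘ w) (Fst w m)) = c0 := by
  induction j with
  | zero =>
    intro c
    refine ⟨id, rig_id, c [], ?_⟩
    intro m f h
    have hm : m = 0 := by
      by_contra hm
      have := h.1 0 (by omega)
      omega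
    have : Fst id 0 = 0 := Fst_eq rfl (by simp)
    rw [hm, this]
    rfl
  | succ j ih =>
    intro c
    let Φ : ℕ → (ℕ → ℕ) → Prop := fun m w => ∀ u : ℕ → ℕ, (∀ x, u x ≤ j) → ∃ c0, ∀ g : ℕ → ℕ,
      (∀ i ≤ m, g i = i) → (∀ x, g x ≤ m) → ∀ i, m < i → c (tr (u ∘ g ∘ w) (Fst w i)) = c0
    obtain ⟨w1, hw1, hΦ⟩ := fusion_s4 Φ
      (by
        intro m w W hw hW hfix h u hu
        obtain ⟨c0, h⟩ := h u hu
        refine ⟨c0, fun g hg hgm i hi => ?_⟩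
        rw [hW.fst_comp hw]
        refine h (g ∘ W) ?_ (fun x => hgm _) _ (lt_of_lt_of_le hi (hW.le_fst i))
        intro i hi
        rw [Function.comp, hfix i hi, hg i hi])
      (by
        intro m w hw
        let ext : (Fin (m + 1) → Fin (j + 1)) → ℕ → ℕ := fun u x =>
          if h : x < m + 1 then u ⟨x, h⟩ else 0
        obtain ⟨W, hW, hfix, c0, h⟩ := cs_stage
          (fun l : List ℕ => fun u : Fin (m + 1) → Fin (j + 1) =>
            c (tr (ext u ∘ (fun x => l.getD x 0) ∘ w) (Fst w l.length))) m
        refine ⟨W, hW, hfix, ?_⟩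
        intro u hu
        let u' : Fin (m + 1) → Fin (j + 1) := fun x => ⟨u x, by have := hu x; omega⟩
        refine ⟨c0 u', fun g hg hgm i hi => ?_⟩
        rw [← h g hg hgm i hi, hW.fst_comp hw, tr_length]
        congr 1
        apply tr_congr
        intro x hx
        have hx' := hw.lt_of_lt hx
        have h1 : (tr (g ∘ W) (Fst W i)).getD (w x) 0 = g (W (w x)) := by
          rw [List.getD_eq_getElem _ _ (by rw [tr_length]; exact hx'), tr_getElem]
          rfl
        have h2 := hgm (W (w x))
        have h3 : g (W (w x)) < m + 1 := by omega
        simp only [Function.comp, h1, ext, h3, dif_pos, u'])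
    have : Nonempty κ := ⟨c []⟩
    choose! c0 hc0 using hΦ
    obtain ⟨w2, hw2, k0, hk0⟩ := ih
      (fun l => c0 l.length (fun x => min j (l.getD x j)))
    refine ⟨w2 ∘ w1, hw2.comp hw1, k0, ?_⟩
    intro m f hf
    obtain ⟨p, hpm, hpj, hfp⟩ := hf.split
    rw [← hk0 p f hfp, tr_length]
    set F := f ∘ w2 with hF
    have hF1 : FW (j + 1) (Fst w2 m) F := hf.comp hw2
    have hF2 : FW j (Fst w2 p) F := hfp.comp hw2
    have hF3 : F (Fst w2 p) = j := by rw [hF, Function.comp, hw2.fst, hpj]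
    obtain ⟨g, hg1, hg2, hg3⟩ := hF2.retract hF3
    rw [← hc0 (Fst w2 p) _ (fun x => min_le_left _ _) g hg1 hg2 (Fst w2 m) (hw2.fst_mono hpm),
      hw2.fst_comp hw1]
    congr 1
    apply tr_congr
    intro x hx
    have hx' := hw1.lt_of_lt hx
    have h1 := hF1.1 _ hx'
    have h2 := hg3 (w1 x) (by omega)
    have h3 := hg2 (w1 x)
    have h4 : (tr F (Fst w2 p)).getD (g (w1 x)) j = F (g (w1 x)) := by
      rcases h3.eq_or_lt with h | h
      · rw [h, hF3, List.getD_eq_default _ _ (by rw [tr_length])]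
      · rw [List.getD_eq_getElem _ _ (by rw [tr_length]; exact h), tr_getElem]
    simp only [Function.comp]
    rw [h4, h2]
    change F (w1 x) = _
    omega

def Cyl {α : Type*} (h : ℕ → α) (l : List α) : Prop := ∀ i (hi : i < l.length), h i = l[i]

theorem Cyl.left {α : Type*} {h : ℕ → α} {l t : List α} (H : Cyl h (l ++ t)) : Cyl h l := by
  intro i hi
  rw [H i (by simp; omega), List.getElem_append_left hi]

theorem cyl_tr {α : Type*} (x : ℕ → α) (h : ℕ → α) (n : ℕ) :
    Cyl h (tr x n) ↔ ∀ i < n, h i = x i := by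
  constructor
  · intro H i hi
    rw [H i (by rw [tr_length]; exact hi), tr_getElem]
  · intro H i hi
    rw [tr_getElem]
    exact H i (by rw [tr_length] at hi; exact hi)

theorem open_cyl {α : Type*} [TopologicalSpace α] [DiscreteTopology α] {U : Set (ℕ → α)}
    (hU : IsOpen U) {x : ℕ → α} (hx : x ∈ U) :
    ∃ n, ∀ N ≥ n, ∀ h, Cyl h (tr x N) → h ∈ U := by
  obtain ⟨V, ⟨y, n, rfl⟩, hxV, hVU⟩ :=
    (PiNat.isTopologicalBasis_cylinders (fun _ => α)).exists_subset_of_mem_open hx hU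
  refine ⟨n, fun N hN h hh => hVU ?_⟩
  rw [cyl_tr] at hh
  rw [PiNat.mem_cylinder_iff] at hxV ⊢
  intro i hi
  rw [hh i (by omega), hxV i hi]

theorem isOpen_cyl {α : Type*} [TopologicalSpace α] [DiscreteTopology α] (l : List α) :
    IsOpen {h : ℕ → α | Cyl h l} := by
  have : {h : ℕ → α | Cyl h l} = ⋂ i : Fin l.length, (fun h : ℕ → α => h i) ⁻¹' {l[i]} := by
    ext h
    simp only [Set.mem_iInter, Set.mem_preimage, Set.mem_singleton_iff]
    exact ⟨fun H i => H i i.2, fun H i hi => H ⟨i, hi⟩⟩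
  rw [this]
  exact isOpen_iInter_of_finite fun i => (isOpen_discrete _).preimage (continuous_apply _)

theorem dense_extend {α : Type*} [TopologicalSpace α] [DiscreteTopology α] [Nonempty α]
    {O : Set (ℕ → α)} (hO : IsOpen O) (hD : Dense O) {F : Set (List α)} (hF : F.Finite) :
    ∃ t : List α, ∀ l ∈ F, ∀ h, Cyl h (l ++ t) → h ∈ O := by
  induction F, hF using Set.Finite.induction_on with
  | empty => exact ⟨[], by simp⟩
  | @insert l0 F _ _ ih =>
    obtain ⟨t0, ht0⟩ := ih
    obtain ⟨a⟩ := ‹Nonempty α›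
    obtain ⟨x, hxc, hxO⟩ := hD.inter_open_nonempty _ (isOpen_cyl (l0 ++ t0))
      ⟨fun i => (l0 ++ t0).getD i a, fun i hi => by
        exact List.getD_eq_getElem _ _ hi⟩
    obtain ⟨n, hn⟩ := open_cyl hO hxO
    have hxc' : Cyl x (l0 ++ t0) := hxc
    have hN := hn ((l0 ++ t0).length + n) (by omega)
    let t1 := (tr x ((l0 ++ t0).length + n)).drop (l0 ++ t0).length
    have ht1 : tr x ((l0 ++ t0).length + n) = (l0 ++ t0) ++ t1 := by
      rw [← List.take_append_drop (l0 ++ t0).length (tr x ((l0 ++ t0).length + n))]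
      congr 1
      apply List.ext_getElem
      · rw [List.length_take, tr_length]; omega
      · intro i h1 h2
        rw [List.getElem_take, tr_getElem]
        exact hxc' i h2
    refine ⟨t0 ++ t1, ?_⟩
    intro l hl h hh
    rw [← List.append_assoc] at hh
    rcases hl with rfl | hl
    · apply hN
      rw [ht1]
      exact hh
    · exact ht0 l hl h hh.left

theorem baire_stage {κ : Type*} [Finite κ] [MeasurableSpace κ] [MeasurableSingletonClass κ]
    (χ : (ℕ → ℕ) → κ) (hχ : Measurable χ) (m : ℕ) :
    ∃ W, Rig W ∧ (∀ i ≤ m, W i = i) ∧ ∃ c0, ∀ g : ℕ → ℕ, (∀ i ≤ m, g i = i) → (∀ x, g x ≤ m) →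
      χ (g ∘ W) = c0 := by
  let pad : (ℕ → Fin (m + 1)) → ℕ → ℕ := fun h x =>
    if x < m + 1 then x else (h (x - (m + 1)) : ℕ)
  have hpad : Measurable pad := by
    apply measurable_pi_lambda
    intro x
    by_cases hx : x < m + 1
    · simp only [pad, hx, if_true]; exact measurable_const
    · simp only [pad, hx, if_false]
      exact (measurable_from_top (f := fun a : Fin (m + 1) => (a : ℕ))).comp (measurable_pi_apply _)
  have hψ : Measurable (χ ∘ pad) := hχ.comp hpad
  have hU : ∀ c, ∃ U : Set (ℕ → Fin (m + 1)), IsOpen U ∧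
      (χ ∘ pad) ⁻¹' {c} =ᶠ[residual (ℕ → Fin (m + 1))] U :=
    fun c => (hψ (measurableSet_singleton c)).residualEq_isOpen
  choose U hUo hUr using hU
  have hall : ∀ᶠ x in residual (ℕ → Fin (m + 1)), ∀ c, (χ (pad x) = c ↔ x ∈ U c) := by
    rw [Filter.eventually_all]
    intro c
    filter_upwards [hUr c] with x hx
    exact iff_of_eq hx
  obtain ⟨S, hSo, hSd, hSc, hSs⟩ := mem_residual_iff.1 hall
  obtain ⟨x0, hx0⟩ := (dense_of_mem_residual hall).nonempty
  set c0 := χ (pad x0)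
  have hx0U : x0 ∈ U c0 := (hx0 c0).1 rfl
  obtain ⟨O, hO⟩ := (hSc.insert Set.univ).exists_eq_range (Set.insert_nonempty _ _)
  have hOo : ∀ i, IsOpen (O i) := by
    intro i
    have : O i ∈ insert Set.univ S := by rw [hO]; exact ⟨i, rfl⟩
    rcases this with h | h
    · rw [h]; exact isOpen_univ
    · exact hSo _ h
  have hOd : ∀ i, Dense (O i) := by
    intro i
    have : O i ∈ insert Set.univ S := by rw [hO]; exact ⟨i, rfl⟩
    rcases this with h | h
    · rw [h]; exact dense_univ
    · exact hSd _ h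
  have hfinal : ∀ h, h ∈ U c0 → (∀ i, h ∈ O i) → χ (pad h) = c0 := by
    intro h h1 h2
    have : h ∈ ⋂₀ S := by
      intro s hs
      have : s ∈ Set.range O := by rw [← hO]; exact Set.mem_insert_of_mem _ hs
      obtain ⟨i, rfl⟩ := this
      exact h2 i
    exact ((hSs this) c0).2 h1
  let OO : ℕ → Set (ℕ → Fin (m + 1)) := fun i => Nat.casesOn i (U c0) O
  let Q : ℕ → List ℕ → Prop := fun i l => ∀ g : ℕ → Fin (m + 1), (∀ a : Fin (m + 1), g a = a) →
    ∀ h, Cyl h (l.map g) → h ∈ OO i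
  obtain ⟨W, hW, hWfix, hWQ⟩ := build m Q
    (by
      obtain ⟨n, hn⟩ := open_cyl (hUo c0) hx0U
      refine ⟨(tr x0 n).map Fin.val, ?_, ?_⟩
      · intro x hx
        obtain ⟨a, -, rfl⟩ := List.mem_map.1 hx
        have := a.2
        omega
      · intro g hg h hh
        rw [List.map_map] at hh
        have : g ∘ Fin.val = id := funext hg
        rw [this, List.map_id] at hh
        exact hn n le_rfl h hh)
    (by
      intro i l _
      obtain ⟨t, ht⟩ := dense_extend (hOo i) (hOd i)
        (List.finite_length_eq (Fin (m + 1)) (l.length + 1))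
      refine ⟨t.map Fin.val, ?_, ?_⟩
      · intro x hx
        obtain ⟨a, -, rfl⟩ := List.mem_map.1 hx
        have := a.2
        omega
      · intro g hg h hh
        refine ht (l.map g ++ [g (m + i + 1)]) (by simp) h ?_
        convert! hh using 1
        rw [List.map_append, List.map_cons, List.map_map]
        have : g ∘ Fin.val = id := funext hg
        rw [this, List.map_id]
        simp)
  refine ⟨W, hW, hWfix, c0, ?_⟩
  intro g hg hgm
  let g' : ℕ → Fin (m + 1) := fun x => ⟨g x, by have := hgm x; omega⟩
  have hg' : ∀ a : Fin (m + 1), g' a = a := fun a => by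
    apply Fin.ext
    exact hg a (by have := a.2; omega)
  let h : ℕ → Fin (m + 1) := fun x => g' (W (m + 1 + x))
  have hh : pad h = g ∘ W := by
    funext x
    by_cases hx : x < m + 1
    · simp only [pad, hx, if_true, Function.comp]
      rw [hWfix x (by omega), hg x (by omega)]
    · simp only [pad, hx, if_false, Function.comp, h, g']
      rw [show m + 1 + (x - (m + 1)) = x by omega]
  have hOO : ∀ i, h ∈ OO i := by
    intro i
    obtain ⟨l, hl, htr⟩ := hWQ i
    apply hl g' hg'
    intro y hy
    rw [List.length_map] at hy
    have h1 : y + (m + 1) < (tr W (Fst W (m + 1 + i))).length := by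
      rw [htr]; simp; omega
    have h2 := tr_getElem W _ _ h1
    simp only [htr] at h2
    rw [List.getElem_append_right (by simp)] at h2
    simp only [List.length_range, Nat.add_sub_cancel] at h2
    rw [List.getElem_map, h2]
    simp only [h]
    rw [Nat.add_comm y]
  rw [← hh]
  exact hfinal h (hOO 0) (fun i => hOO (i + 1))

theorem borel_ramsey {κ : Type*} [Finite κ] [MeasurableSpace κ] [MeasurableSingletonClass κ]
    (j : ℕ) (χ : (ℕ → ℕ) → κ) (hχ : Measurable χ) :
    ∃ w, Rig w ∧ ∃ c0, ∀ f : ℕ → ℕ, (∀ x, f x ≤ j) → (∀ b ≤ j, ∃ x, f x = b) →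
      (∀ x, ∀ b < f x, ∃ y < x, f y = b) → χ (f ∘ w) = c0 := by
  let Φ : ℕ → (ℕ → ℕ) → Prop := fun m w => ∀ u : ℕ → ℕ, (∀ x, u x ≤ j) → ∃ c0, ∀ g : ℕ → ℕ,
    (∀ i ≤ m, g i = i) → (∀ x, g x ≤ m) → χ (u ∘ g ∘ w) = c0
  obtain ⟨w1, hw1, hΦ⟩ := fusion_s4 Φ
    (by
      intro m w W hw hW hfix h u hu
      obtain ⟨c0, h⟩ := h u hu
      refine ⟨c0, fun g hg hgm => ?_⟩
      refine h (g ∘ W) ?_ (fun x => hgm _)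
      intro i hi
      rw [Function.comp, hfix i hi, hg i hi])
    (by
      intro m w hw
      let ext : (Fin (m + 1) → Fin (j + 1)) → ℕ → ℕ := fun u x =>
        if h : x < m + 1 then u ⟨x, h⟩ else 0
      obtain ⟨W, hW, hfix, c0, h⟩ := baire_stage
        (fun l : ℕ → ℕ => fun u : Fin (m + 1) → Fin (j + 1) => χ (ext u ∘ l ∘ w))
        (by
          apply measurable_pi_lambda
          intro u
          apply hχ.comp
          apply measurable_pi_lambda
          intro x
          exact (measurable_from_top (f := ext u)).comp (measurable_pi_apply (w x))) m
      refine ⟨W, hW, hfix, ?_⟩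
      intro u hu
      let u' : Fin (m + 1) → Fin (j + 1) := fun x => ⟨u x, by have := hu x; omega⟩
      refine ⟨c0 u', fun g hg hgm => ?_⟩
      rw [← h g hg hgm]
      congr 1
      funext x
      have h2 := hgm (W (w x))
      have h3 : g (W (w x)) < m + 1 := by omega
      simp only [Function.comp, ext, h3, dif_pos, u'])
  have : Nonempty κ := ⟨χ id⟩
  choose! c0 hc0 using hΦ
  obtain ⟨w2, hw2, k0, hk0⟩ := finite_ramsey j
    (fun l => c0 l.length (fun x => min j (l.getD x j)))
  refine ⟨w2 ∘ w1, hw2.comp hw1, k0, ?_⟩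
  intro f hf1 hf2 hf3
  obtain ⟨p, hpj, hfp⟩ : ∃ p, f p = j ∧ FW j p f := by
    classical
    have hex := hf2 j le_rfl
    refine ⟨Nat.find hex, Nat.find_spec hex, ?_, ?_, ?_⟩
    · intro y hy
      have h1 := hf1 y
      have h2 := Nat.find_min hex hy
      omega
    · intro b hb
      exact hf3 _ b (by rw [Nat.find_spec hex]; exact hb)
    · intro y hy
      exact hf3 y
  rw [← hk0 p f hfp, tr_length]
  set F := f ∘ w2 with hF
  have hF2 : FW j (Fst w2 p) F := hfp.comp hw2
  have hF3 : F (Fst w2 p) = j := by rw [hF, Function.comp, hw2.fst, hpj]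
  obtain ⟨g, hg1, hg2, hg3⟩ := hF2.retract hF3
  rw [← hc0 (Fst w2 p) _ (fun x => min_le_left _ _) g hg1 hg2]
  congr 1
  funext x
  have h1 : F (w1 x) ≤ j := hf1 _
  have h2 := hg3 (w1 x) h1
  have h3 := hg2 (w1 x)
  have h4 : (tr F (Fst w2 p)).getD (g (w1 x)) j = F (g (w1 x)) := by
    rcases h3.eq_or_lt with h | h
    · rw [h, hF3, List.getD_eq_default _ _ (by rw [tr_length])]
    · rw [List.getD_eq_getElem _ _ (by rw [tr_length]; exact h), tr_getElem]
  simp only [Function.comp]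
  rw [h4, h2]
  change F (w1 x) = _
  omega

/-- The dual big Ramsey degree of every finite linearly ordered metric space `(M, d, <)`
in `Ω^<` with respect to non-expansive rigid surjections and Borel colorings equals 1:
every Borel coloring of the non-expansive rigid surjections `Ω^< → (M, d, <)` is
constant on `{f ∘ w : f ∈ H}` for some non-expansive rigid surjection `w : Ω^< → Ω^<`. -/
theorem stmt_4 (M : Type) [MetricSpace M] [LinearOrder M] [Fintype M] [Nonempty M]
    (k : ℕ) (hk : 1 ≤ k)
    (χ : {f : ℕ → M // IsOmegaNESurj f ∧ IsRigidSurj f} → Fin k)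
    (hχ : ∀ i : Fin k, @MeasurableSet _ (borel (ℕ → M)) (Subtype.val '' (χ ⁻¹' {i}))) :
    ∃ w : ℕ → ℕ, IsOmegaNESurjSelf w ∧ IsRigidSurj w ∧
      ∃ c : Fin k, ∀ g : {f : ℕ → M // IsOmegaNESurj f ∧ IsRigidSurj f},
        (∃ f : ℕ → M, (IsOmegaNESurj f ∧ IsRigidSurj f) ∧ g.1 = f ∘ w) → χ g = c := by
  classical
  obtain ⟨j, hj⟩ : ∃ j, Fintype.card M = j + 1 :=
    Nat.exists_eq_succ_of_ne_zero Fintype.card_ne_zero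
  let e : Fin (j + 1) ≃o M := Fintype.orderIsoFinOfCardEq M hj
  let φ : ℕ → M := fun a => e ⟨min a j, by omega⟩
  let _ : MeasurableSpace (ℕ → M) := borel _
  have _ : BorelSpace (ℕ → M) := ⟨rfl⟩
  let _ : MeasurableSpace (Option (Fin k)) := ⊤
  let P : (ℕ → M) → Prop := fun f => IsOmegaNESurj f ∧ IsRigidSurj f
  let χ0 : (ℕ → M) → Option (Fin k) := fun f => if h : P f then some (χ ⟨f, h⟩) else none
  have hsome : ∀ i, χ0 ⁻¹' {some i} = Subtype.val '' (χ ⁻¹' {i}) := by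
    intro i
    ext f
    simp only [Set.mem_preimage, Set.mem_singleton_iff, Set.mem_image, χ0]
    constructor
    · intro h
      split_ifs at h with hP
      exact ⟨⟨f, hP⟩, Option.some_injective _ h, rfl⟩
    · rintro ⟨⟨f, hP⟩, h, rfl⟩
      rw [dif_pos hP, h]
  have hnone : χ0 ⁻¹' {none} = (⋃ i, χ0 ⁻¹' {some i})ᶜ := by
    ext f
    simp only [Set.mem_preimage, Set.mem_singleton_iff, Set.mem_compl_iff, Set.mem_iUnion]
    cases χ0 f <;> simp
  have hχ0 : Measurable χ0 := by
    apply measurable_to_countable'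
    have h1 : ∀ i, MeasurableSet (χ0 ⁻¹' {some i}) := by
      intro i
      rw [hsome]
      exact hχ i
    intro o
    cases o with
    | none =>
      rw [hnone]
      exact (MeasurableSet.iUnion h1).compl
    | some i => exact h1 i
  have hφ : Measurable (fun F : ℕ → ℕ => φ ∘ F) := by
    apply Continuous.measurable
    apply continuous_pi
    intro x
    exact (continuous_of_discreteTopology (f := φ)).comp (continuous_apply x)
  obtain ⟨w, hw, c0, hc0⟩ := borel_ramsey j (fun F => χ0 (φ ∘ F)) (hχ0.comp hφ)
  refine ⟨w, ⟨hw.1, ?_⟩, ⟨hw.1, fun b₁ b₂ h => hw.fst_mono h⟩, c0.getD ⟨0, hk⟩, ?_⟩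
  · intro x y _
    exact max_le_max (hw.le x) (hw.le y)
  · rintro ⟨g, hg⟩ ⟨f, hf, rfl⟩
    have hF := hc0 (fun x => (e.symm (f x) : ℕ))
      (fun x => by have := (e.symm (f x)).2; omega)
      (by
        intro b hb
        obtain ⟨x, hx⟩ := hf.1.1 (e ⟨b, by omega⟩)
        exact ⟨x, by simp [hx]⟩)
      (by
        intro x b hb
        have hbj : b < j + 1 := by have := (e.symm (f x)).2; omega
        have hlt : e ⟨b, hbj⟩ < f x := by
          rw [← e.lt_symm_apply]
          exact hb
        have h1 := hf.2.2 _ _ hlt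
        have h2 : sInf {y | f y = f x} ≤ x := Nat.sInf_le rfl
        have h3 : sInf {y | f y = e ⟨b, hbj⟩} ∈ {y | f y = e ⟨b, hbj⟩} :=
          Nat.sInf_mem (hf.1.1 _)
        have h4 : f (sInf {y | f y = e ⟨b, hbj⟩}) = e ⟨b, hbj⟩ := h3
        exact ⟨_, lt_of_lt_of_le h1 h2, by simp [h4]⟩)
    have hcomp : φ ∘ ((fun x => (e.symm (f x) : ℕ)) ∘ w) = f ∘ w := by
      funext x
      simp only [Function.comp, φ]
      have h1 : min ((e.symm (f (w x)) : Fin (j + 1)) : ℕ) j = (e.symm (f (w x)) : Fin (j + 1)) := by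
        have := (e.symm (f (w x))).2
        omega
      simp [h1]
    rw [hcomp] at hF
    have hP : P (f ∘ w) := hg
    simp only [χ0, dif_pos hP] at hF
    rw [← hF]
    rfl
end

section
/- For all finite edge-ordered reflexive digraphs A and B and every k ≥ 1, there exists a finite edge-ordered reflexive digraph C such that for every coloring χ : QRS(C, A) → Fin k there exists a quotient rigid surjection w ∈ QRS(C, B) such that χ(f ∘ w) takes the same value for all f ∈ QRS(B, A). (The category of finite edge-ordered reflexive digraphs and quotient rigid surjections has the dual Ramsey property.) -/
/-- A finite edge-ordered reflexive digraph: a finite reflexive digraph `(V, rel)`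
together with a tidy linear order `ele` on its edge set (loops precede non-loops). -/
structure EODigraph where
  V : Type
  finite : Finite V
  rel : V → V → Prop
  refl : ∀ x, rel x x
  ele : {p : V × V // rel p.1 p.2} → {p : V × V // rel p.1 p.2} → Prop
  lin : IsLinearOrder {p : V × V // rel p.1 p.2} ele
  tidy : ∀ e e' : {p : V × V // rel p.1 p.2},
    e.1.1 = e.1.2 → e'.1.1 ≠ e'.1.2 → ele e e' ∧ e ≠ e'

/-- The edge set of an edge-ordered reflexive digraph. -/
def EODigraph.Edge (G : EODigraph) : Type := {p : G.V × G.V // G.rel p.1 p.2}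

/-- The strict edge order of an edge-ordered reflexive digraph. -/
def EODigraph.elt (G : EODigraph) (e e' : G.Edge) : Prop := G.ele e e' ∧ e ≠ e'

/-- A quotient map between relational structures: a surjective map which preserves
and reflects the relation. -/
def IsQuot {V W : Type*} (ρ : V → V → Prop) (σ : W → W → Prop) (f : V → W) : Prop :=
  Function.Surjective f ∧ (∀ x y, ρ x y → σ (f x) (f y)) ∧
    ∀ u v, σ u v → ∃ x y, ρ x y ∧ f x = u ∧ f y = v

/-- A quotient rigid surjection between finite edge-ordered reflexive digraphs:
a quotient map `f` such that the induced map `f̂` on edges is a rigid surjection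
between the edge orders (for `d₁ < d₂` in `H`, the least edge of `G` mapping onto
`d₁` strictly precedes the least edge of `G` mapping onto `d₂`). -/
def QRS (G H : EODigraph) (f : G.V → H.V) : Prop :=
  IsQuot G.rel H.rel f ∧
  ∀ d₁ d₂ : H.Edge, H.elt d₁ d₂ →
    ∃ m₁ m₂ : G.Edge,
      (f m₁.1.1, f m₁.1.2) = d₁.1 ∧ (f m₂.1.1, f m₂.1.2) = d₂.1 ∧
      (∀ e : G.Edge, (f e.1.1, f e.1.2) = d₁.1 → G.ele m₁ e) ∧
      (∀ e : G.Edge, (f e.1.1, f e.1.2) = d₂.1 → G.ele m₂ e) ∧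
      G.elt m₁ m₂

namespace EOD

inductive RW : ℕ → ℕ → List ℕ → Prop
  | nil (a : ℕ) : RW a 0 []
  | const {a k x : ℕ} {l : List ℕ} : x < a → RW a k l → RW a k (x :: l)
  | param {a k : ℕ} {l : List ℕ} : RW (a + 1) k l → RW a (k + 1) (a :: l)

theorem RW.cons_cases {a k x : ℕ} {l : List ℕ} (h : RW a k (x :: l)) :
    (x < a ∧ RW a k l) ∨ (x = a ∧ ∃ k', k = k' + 1 ∧ RW (a + 1) k' l) := by
  cases h with
  | const h1 h2 => exact Or.inl ⟨h1, h2⟩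
  | param h => exact Or.inr ⟨rfl, _, rfl, h⟩

theorem RW.subst {a m : ℕ} {w : List ℕ} (h : RW a m w) : ∀ {b k : ℕ} {σ : ℕ → ℕ},
    (∀ x < a, σ x < b) → RW b k ((List.range' a m).map σ) → RW b k (w.map σ) := by
  induction h with
  | nil a => intro b k σ _ h; simpa using h
  | const hx _ ih => intro b k σ hσ h; exact RW.const (hσ _ hx) (ih hσ h)
  | @param a m l _ ih =>
    intro b k σ hσ h
    rw [List.range'_succ, List.map_cons] at h
    rcases h.cons_cases with ⟨h1, h2⟩ | ⟨h1, k', rfl, h2⟩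
    · refine RW.const h1 (ih ?_ h2)
      intro x hx
      rcases Nat.lt_succ_iff_lt_or_eq.1 hx with h | rfl
      · exact hσ _ h
      · exact h1
    · rw [List.map_cons, h1]
      refine RW.param (ih ?_ h2)
      intro x hx
      rcases Nat.lt_succ_iff_lt_or_eq.1 hx with h | rfl
      · have := hσ _ h; omega
      · omega

theorem RW.lt {a m : ℕ} {w : List ℕ} (h : RW a m w) : ∀ x ∈ w, x < a + m := by
  induction h with
  | nil a => simp
  | const hx _ ih =>
    intro y hy
    rcases List.mem_cons.1 hy with rfl | hy
    · omega
    · exact ih _ hy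
  | param _ ih =>
    intro y hy
    rcases List.mem_cons.1 hy with rfl | hy
    · omega
    · have := ih _ hy; omega

theorem RW.decomp {a m : ℕ} {w : List ℕ} (h : RW a m w) : ∀ j, a ≤ j → j < a + m →
    ∃ p s, w = p ++ j :: s ∧ ∀ x ∈ p, x < j := by
  induction h with
  | nil a => intro j _ _; omega
  | @const a k x l hx _ ih =>
    intro j h1 h2
    obtain ⟨p, s, rfl, hp⟩ := ih j h1 h2
    refine ⟨x :: p, s, rfl, ?_⟩
    intro y hy
    rcases List.mem_cons.1 hy with rfl | hy
    · omega
    · exact hp _ hy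
  | @param a k l _ ih =>
    intro j h1 h2
    rcases Nat.eq_or_lt_of_le h1 with rfl | h1
    · exact ⟨[], l, rfl, by simp⟩
    obtain ⟨p, s, rfl, hp⟩ := ih j h1 (by omega)
    refine ⟨a :: p, s, rfl, ?_⟩
    intro y hy
    rcases List.mem_cons.1 hy with rfl | hy
    · omega
    · exact hp _ hy

theorem RW.of_decomp : ∀ (w : List ℕ) (a m : ℕ), (∀ x ∈ w, x < a + m) →
    (∀ j, a ≤ j → j < a + m → ∃ p s, w = p ++ j :: s ∧ ∀ x ∈ p, x < j) → RW a m w := by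
  intro w
  induction w with
  | nil =>
    intro a m _ h
    rcases m with _ | m
    · exact RW.nil a
    · obtain ⟨p, s, h, _⟩ := h a le_rfl (by omega)
      simp at h
  | cons x l ih =>
    intro a m hlt h
    by_cases hx : x < a
    · refine RW.const hx (ih a m (fun y hy => hlt y (List.mem_cons_of_mem _ hy)) ?_)
      intro j h1 h2
      obtain ⟨p, s, he, hp⟩ := h j h1 h2
      rcases p with _ | ⟨y, p⟩
      · simp at he; omega
      · simp only [List.cons_append, List.cons.injEq] at he
        exact ⟨p, s, he.2, fun z hz => hp z (List.mem_cons_of_mem _ hz)⟩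
    · have hxm := hlt x List.mem_cons_self
      obtain ⟨p, s, he, hp⟩ := h a le_rfl (by omega)
      have hxa : x = a := by
        rcases p with _ | ⟨y, p⟩
        · simp at he; exact he.1
        · simp only [List.cons_append, List.cons.injEq] at he
          have := hp y List.mem_cons_self
          omega
      subst hxa
      obtain ⟨m, rfl⟩ : ∃ m', m = m' + 1 := ⟨m - 1, by omega⟩
      refine RW.param (ih _ _ (fun y hy => ?_) ?_)
      · have := hlt y (List.mem_cons_of_mem _ hy); omega
      intro j h1 h2
      obtain ⟨p, s, he, hp⟩ := h j (by omega) (by omega)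
      rcases p with _ | ⟨y, p⟩
      · simp at he; omega
      · simp only [List.cons_append, List.cons.injEq] at he
        exact ⟨p, s, he.2, fun z hz => hp z (List.mem_cons_of_mem _ hz)⟩

/-- shift the letters `≥ c` by one -/
def lft (c y : ℕ) : ℕ := if y < c then y else y + 1

theorem RW.lift {a m c : ℕ} {w : List ℕ} (h : RW a m w) : c ≤ a →
    RW (a + 1) m (w.map (lft c)) := by
  induction h with
  | nil a => intro _; exact RW.nil _
  | const hx _ ih =>
    intro hc
    refine RW.const ?_ (ih hc)
    unfold lft; split <;> omega
  | @param a m l _ ih =>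
    intro hc
    have : lft c a = a + 1 := by unfold lft; rw [if_neg (by omega)]
    rw [List.map_cons, this]
    exact RW.param (ih (by omega))

/-- the prefix consisting of letters below `c` -/
def pre (c : ℕ) (l : List ℕ) : List ℕ := l.takeWhile (fun x => decide (x < c))

theorem pre_cons_lt {c x : ℕ} {l : List ℕ} (h : x < c) : pre c (x :: l) = x :: pre c l := by
  simp [pre, h]

theorem pre_cons_ge {c x : ℕ} {l : List ℕ} (h : ¬ x < c) : pre c (x :: l) = [] := by
  simp [pre, h]

theorem pre_append {c : ℕ} {p l : List ℕ} (h : ∀ x ∈ p, x < c) :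
    pre c (p ++ l) = p ++ pre c l := by
  induction p with
  | nil => rfl
  | cons x p ih =>
    rw [List.cons_append, pre_cons_lt (h x List.mem_cons_self),
      ih (fun y hy => h y (List.mem_cons_of_mem _ hy)), List.cons_append]

theorem pre_append_of_mem {c y : ℕ} {p l : List ℕ} (hy : y ∈ p) (h : ¬ y < c) :
    pre c (p ++ l) = pre c p := by
  induction p with
  | nil => simp at hy
  | cons x p ih =>
    by_cases hx : x < c
    · rw [List.cons_append, pre_cons_lt hx, pre_cons_lt hx, ih]
      rcases List.mem_cons.1 hy with rfl | hy
      · exact absurd hx h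
      · exact hy
    · rw [List.cons_append, pre_cons_ge hx, pre_cons_ge hx]

theorem pre_lift {a : ℕ} {l : List ℕ} : pre (a + 1) (l.map (lft a)) = (pre a l).map (lft a) := by
  induction l with
  | nil => rfl
  | cons x l ih =>
    by_cases hx : x < a
    · have : lft a x < a + 1 := by unfold lft; split <;> omega
      rw [List.map_cons, pre_cons_lt this, pre_cons_lt hx, ih, List.map_cons]
    · have : ¬ lft a x < a + 1 := by unfold lft; split <;> omega
      rw [List.map_cons, pre_cons_ge this, pre_cons_ge hx, List.map_nil]

/-- substitution attached to a word -/
def sub (a : ℕ) (l : List ℕ) (x : ℕ) : ℕ := if x < a then x else l.getD (x - a) 0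

theorem sub_lt {a x : ℕ} {l : List ℕ} (h : x < a) : sub a l x = x := by
  unfold sub; rw [if_pos h]

theorem map_subst_word {a n : ℕ} {l : List ℕ} (h : l.length = n) :
    (List.range' a n).map (sub a l) = l := by
  subst h
  apply List.ext_getElem
  · simp
  · intro i h1 h2
    simp [sub, h2]

theorem RW.map_congr {a m : ℕ} {w : List ℕ} (h : RW a m w) {σ τ : ℕ → ℕ}
    (h1 : ∀ x < a + m, σ x = τ x) : w.map σ = w.map τ :=
  List.map_congr_left (fun x hx => h1 x (h.lt x hx))

theorem sub_map {a m : ℕ} {l : List ℕ} {σ : ℕ → ℕ} (hl : l.length = m)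
    (hσ : ∀ x < a, σ x = x) : ∀ x < a + m, sub a (l.map σ) x = σ (sub a l x) := by
  intro x hx
  unfold sub
  split
  · rw [hσ _ (by assumption)]
  · have : x - a < l.length := by omega
    simp [this]

theorem RW.rep {a m n : ℕ} {w : List ℕ} (h : RW a m w) (hn : w.length = n) :
    RW a m ((List.range' a n).map (sub a w)) := by
  rw [map_subst_word hn]; exact h

theorem hj_fin (α κ : Type) [Finite α] [Finite κ] : ∃ n, ∀ C : (Fin n → α) → κ,
    ∃ h : Fin n → Option α, (∃ i, h i = none) ∧ ∃ c, ∀ x, C (fun i => (h i).getD x) = c := by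
  obtain ⟨n, hn⟩ := Combinatorics.Subspace.exists_mono_in_high_dimension_fin α κ Unit
  refine ⟨n, fun C => ?_⟩
  obtain ⟨l, c, hc⟩ := hn C
  refine ⟨fun i => Sum.elim some (fun _ => none) (l.idxFun i), ?_, c, ?_⟩
  · obtain ⟨i, hi⟩ := l.proper ()
    exact ⟨i, by simp [hi]⟩
  · intro x
    rw [← hc (fun _ => x)]
    congr 1
    funext i
    rw [Combinatorics.Subspace.apply_def]
    cases h : l.idxFun i <;> simp [h]

theorem RW.append_left {a k : ℕ} {p l : List ℕ} (hp : ∀ x ∈ p, x < a) (h : RW a k l) :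
    RW a k (p ++ l) := by
  induction p with
  | nil => exact h
  | cons x p ih =>
    exact RW.const (hp x List.mem_cons_self) (ih (fun y hy => hp y (List.mem_cons_of_mem _ hy)))

theorem RW.of_lt {a : ℕ} {p : List ℕ} (hp : ∀ x ∈ p, x < a) : RW a 0 p := by
  simpa using RW.append_left hp (RW.nil a)

theorem RW.range_append {m : ℕ} : ∀ {a : ℕ} {l : List ℕ}, (∀ x ∈ l, x < a + m) →
    RW a m (List.range' a m ++ l) := by
  induction m with
  | zero => intro a l h; exact RW.of_lt h
  | succ m ih =>
    intro a l h
    rw [List.range'_succ, List.cons_append]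
    exact RW.param (ih (fun x hx => by have := h x hx; omega))

/-- the Graham-Rothschild property -/
def GR (a k m : ℕ) : Prop := ∀ (κ : Type) [Finite κ], ∃ n, ∀ χ : List ℕ → κ,
  ∃ w : List ℕ, w.length = n ∧ RW a m w ∧ ∃ c, ∀ σ : ℕ → ℕ, (∀ x < a, σ x = x) →
    RW a k ((List.range' a m).map σ) → χ (w.map σ) = c

/-- block attached to a vector -/
def gblk {a m : ℕ} (y : Fin m → Fin a) : List ℕ := List.ofFn (fun j => (y j : ℕ))

/-- block attached to a letter of a line -/
def blk {a m : ℕ} : Option (Fin m → Fin a) → List ℕ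
  | none => List.range' a m
  | some y => gblk y

theorem gblk_lt {a m : ℕ} (y : Fin m → Fin a) : ∀ x ∈ gblk y, x < a := by
  intro x hx
  obtain ⟨j, rfl⟩ := (List.mem_ofFn' _ _).1 hx
  exact (y j).2

theorem blk_lt {a m : ℕ} (y : Option (Fin m → Fin a)) : ∀ x ∈ blk y, x < a + m := by
  intro x hx
  cases y with
  | none => simp [blk] at hx; omega
  | some y => have := gblk_lt y x hx; omega

theorem blk_length {a m : ℕ} (y : Option (Fin m → Fin a)) : (blk y).length = m := by
  cases y <;> simp [blk, gblk]

theorem RW.flat {a m : ℕ} (l : List (Option (Fin m → Fin a))) (h : none ∈ l) :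
    RW a m (l.flatMap blk) := by
  induction l with
  | nil => simp at h
  | cons y l ih =>
    rw [List.flatMap_cons]
    cases y with
    | none =>
      apply RW.range_append
      intro x hx
      obtain ⟨y, _, hy⟩ := List.mem_flatMap.1 hx
      exact blk_lt y x hy
    | some y =>
      exact RW.append_left (gblk_lt y) (ih (by simpa using h))

theorem RW.zero_lt {a k : ℕ} {l : List ℕ} (h : RW a k l) (hk : k = 0) : ∀ x ∈ l, x < a := by
  subst hk; exact h.lt

theorem GR_zero (a m : ℕ) : GR a 0 m := by
  intro κ _
  obtain ⟨n, hn⟩ := hj_fin (Fin m → Fin a) κ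
  refine ⟨n * m, fun χ => ?_⟩
  obtain ⟨h, ⟨i, hi⟩, c, hc⟩ := hn (fun v => χ ((List.ofFn v).flatMap gblk))
  refine ⟨(List.ofFn h).flatMap blk, ?_, ?_, c, ?_⟩
  · rw [List.length_flatMap]
    have : (List.ofFn h).map (fun y => (blk y).length) = List.replicate n m := by
      simp only [blk_length]
      rw [List.map_const', List.length_ofFn]
    rw [this]
    simp
  · exact RW.flat _ ((List.mem_ofFn' _ _).2 ⟨i, hi⟩)
  · intro σ hσ hr
    have hr' := hr.lt
    have hlt : ∀ j : Fin m, σ (a + j) < a := by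
      intro j
      apply hr'
      rw [List.mem_map]
      exact ⟨a + j, by simp, rfl⟩
    rw [← hc (fun j => ⟨σ (a + j), hlt j⟩)]
    congr 1
    rw [List.map_flatMap]
    have : (List.ofFn fun i => (h i).getD (fun j => ⟨σ (a + j), hlt j⟩)) =
        (List.ofFn h).map (fun y => y.getD (fun j => ⟨σ (a + j), hlt j⟩)) := by
      rw [List.map_ofFn]; rfl
    rw [this, List.flatMap_map]
    congr 1
    funext y
    cases y with
    | none =>
      apply List.ext_getElem
      · simp [blk, gblk]
      · intro i h1 h2
        simp [blk, gblk]
    | some y =>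
      apply List.ext_getElem
      · simp [blk, gblk]
      · intro i h1 h2
        simp [blk, gblk, hσ]

theorem RW.not_nil {a k : ℕ} (h : RW a (k + 1) []) : False := by cases h

/-- Stage one: the colour depends on the prefix only. -/
theorem stage1 (k : ℕ) (IH : ∀ a m, GR a k m) : ∀ (t a : ℕ) (κ : Type) [Finite κ],
    ∃ N, ∀ χ : List ℕ → κ, ∃ w : List ℕ, w.length = N ∧ RW a t w ∧
      ∀ σ σ' : ℕ → ℕ, (∀ x < a, σ x = x) → (∀ x < a, σ' x = x) →
        RW a (k + 1) ((List.range' a t).map σ) → RW a (k + 1) ((List.range' a t).map σ') →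
        pre a ((List.range' a t).map σ) = pre a ((List.range' a t).map σ') →
        χ (w.map σ) = χ (w.map σ') := by
  intro t
  induction t with
  | zero =>
    intro a κ _
    refine ⟨0, fun χ => ⟨[], rfl, RW.nil a, fun σ σ' _ _ h => ?_⟩⟩
    exact (RW.not_nil h).elim
  | succ t ih =>
    intro a κ _
    obtain ⟨T, hT⟩ := ih (a + 1) (Fin a → κ)
    obtain ⟨N, hN⟩ := IH (a + 1) T κ
    refine ⟨N + 1, fun χ => ?_⟩
    obtain ⟨w1, hl1, hw1, c, hc⟩ := hN (fun u => χ (a :: u))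
    let ρ : ℕ → ℕ → ℕ := fun x y => if y < a then y else if y = a then x else y - 1
    obtain ⟨w2, hl2, hw2, hd⟩ :=
      hT (fun u x => χ ((x : ℕ) :: (w1.map (sub (a + 1) u)).map (ρ x)))
    refine ⟨a :: w1.map (sub (a + 1) w2), by simp [hl1], ?_, ?_⟩
    · refine RW.param (hw1.subst (fun x hx => by rwa [sub_lt hx]) ?_)
      rw [map_subst_word hl2]
      exact hw2
    -- the case where the first letter is the parameter
    have case1 : ∀ σ : ℕ → ℕ, (∀ x < a, σ x = x) → σ a = a →
        (∃ k', k + 1 = k' + 1 ∧ RW (a + 1) k' ((List.range' (a + 1) t).map σ)) →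
        χ ((a :: w1.map (sub (a + 1) w2)).map σ) = c := by
      rintro σ hσ ha ⟨k', hk, hr⟩
      obtain rfl : k' = k := by omega
      have hσ1 : ∀ x < a + 1, σ x = x := by
        intro x hx
        rcases Nat.lt_succ_iff_lt_or_eq.1 hx with h | rfl
        · exact hσ _ h
        · exact ha
      rw [List.map_cons, ha, List.map_map]
      refine hc _ ?_ ?_
      · intro x hx
        rw [Function.comp_apply, sub_lt hx, hσ1 x hx]
      · rw [← List.map_map, map_subst_word hl2]
        exact hw2.subst (fun x hx => by rwa [hσ1 x hx]) hr
    -- the case where the first letter is a constant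
    let ext : (ℕ → ℕ) → ℕ → ℕ := fun σ y => if y < a + 1 then y else lft a (σ y)
    have hext : ∀ σ : ℕ → ℕ, (List.range' (a + 1) t).map (ext σ) =
        ((List.range' (a + 1) t).map σ).map (lft a) := by
      intro σ
      rw [List.map_map]
      apply List.map_congr_left
      intro x hx
      have : ¬ x < a + 1 := by simp at hx; omega
      simp only [ext, if_neg this, Function.comp_apply]
    have case2 : ∀ (σ : ℕ → ℕ) (x : Fin a), (∀ x < a, σ x = x) → σ a = x →
        χ ((a :: w1.map (sub (a + 1) w2)).map σ) =
        (fun u (x : Fin a) => χ ((x : ℕ) :: (w1.map (sub (a + 1) u)).map (ρ x)))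
          (w2.map (ext σ)) x := by
      intro σ x hσ hx
      simp only [List.map_cons, hx, List.map_map]
      congr 2
      apply hw1.map_congr
      intro y hy
      have h1 : ∀ x < a + 1, ext σ x = x := by
        intro x hx; simp only [ext, if_pos hx]
      rw [Function.comp_apply, Function.comp_apply, sub_map hl2 h1 y hy]
      generalize sub (a + 1) w2 y = z
      simp only [ρ, ext, lft]
      have hxa := x.2
      by_cases hz : z < a
      · rw [hσ z hz]
        simp [hz, Nat.lt_succ_of_lt hz]
      · by_cases hz' : z = a
        · subst hz'
          simp [hx]
        · have h3 : ¬ z < a + 1 := by omega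
          simp only [if_neg h3]
          by_cases h4 : σ z < a
          · simp [h4]
          · have h5 : ¬ σ z + 1 < a := by omega
            have h6 : ¬ σ z + 1 = a := by omega
            simp [h4, h5, h6]
    intro σ σ' hσ hσ' hr hr' hp
    rw [List.range'_succ, List.map_cons] at hr hr' hp
    rw [List.map_cons] at hp
    rcases hr.cons_cases with ⟨h1, h2⟩ | ⟨h1, h2⟩ <;>
      rcases hr'.cons_cases with ⟨h1', h2'⟩ | ⟨h1', h2'⟩
    · rw [pre_cons_lt h1, pre_cons_lt h1', List.cons.injEq] at hp
      rw [case2 σ ⟨σ a, h1⟩ hσ rfl, case2 σ' ⟨σ a, h1⟩ hσ' hp.1.symm]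
      refine congrFun (hd _ _ (fun x hx => by simp only [ext, if_pos hx])
        (fun x hx => by simp only [ext, if_pos hx]) ?_ ?_ ?_) _
      · rw [hext]; exact h2.lift le_rfl
      · rw [hext]; exact h2'.lift le_rfl
      · rw [hext, hext, pre_lift, pre_lift, hp.2]
    · rw [pre_cons_lt h1, pre_cons_ge (by omega)] at hp; simp at hp
    · rw [pre_cons_lt h1', pre_cons_ge (by omega)] at hp; simp at hp
    · rw [case1 σ hσ h1 h2, case1 σ' hσ' h1' h2']

theorem RW.line_append {a t : ℕ} {h l : List ℕ} (hl : RW (a + 1) t l) (hh : ∀ x ∈ h, x < a + 1)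
    (ha : a ∈ h) : RW a (t + 1) (h ++ l) := by
  induction h with
  | nil => simp at ha
  | cons x h ih =>
    have hrest : ∀ y ∈ h, y < a + 1 := fun y hy => hh y (List.mem_cons_of_mem _ hy)
    rcases Nat.lt_succ_iff_lt_or_eq.1 (hh x List.mem_cons_self) with hx | rfl
    · refine RW.const hx (ih hrest ?_)
      rcases List.mem_cons.1 ha with rfl | h
      · omega
      · exact h
    · exact RW.param (RW.append_left hrest hl)

/-- Stage two: the colour depends on the length of the prefix only. -/
theorem stage2 (a : ℕ) : ∀ (t : ℕ) (κ : Type) [Finite κ],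
    ∃ M, ∀ c : List ℕ → κ, ∃ W : List ℕ, W.length = M ∧ RW a t W ∧
      ∃ d : ℕ → κ, ∀ (σ : ℕ → ℕ) (p s : List ℕ), (∀ x < a, σ x = x) →
        (List.range' a t).map σ = p ++ a :: s → (∀ x ∈ p, x < a) →
        c (pre a (W.map σ)) = d p.length := by
  intro t
  induction t with
  | zero =>
    intro κ _
    refine ⟨0, fun c => ⟨[], rfl, RW.nil a, fun _ => c [], fun σ p s _ h => ?_⟩⟩
    simp at h
  | succ t ih =>
    intro κ _
    obtain ⟨L, hL⟩ := hj_fin (Fin a) (Fin t → κ)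
    obtain ⟨M, hM⟩ := ih ((Fin L → Fin a) → κ)
    refine ⟨L + M, fun c => ?_⟩
    obtain ⟨W, hlW, hW, d, hd⟩ := hM (fun u p => c (gblk p ++ u))
    obtain ⟨h, ⟨i0, hi0⟩, e, he⟩ := hL (fun p j => d j p)
    let H : List ℕ := List.ofFn (fun i => (h i).elim a (fun y => (y : ℕ)))
    have hH : ∀ x ∈ H, x < a + 1 := by
      intro x hx
      obtain ⟨i, rfl⟩ := (List.mem_ofFn' _ _).1 hx
      show (h i).elim a (fun y => (y : ℕ)) < a + 1
      rcases h i with _ | y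
      · simp
      · have := y.2
        simp
    have haH : a ∈ H := (List.mem_ofFn' _ _).2 ⟨i0, by simp [hi0]⟩
    refine ⟨H ++ W.map (lft a), by simp [H, hlW], (hW.lift le_rfl).line_append hH haH,
      fun i => if hi : i - 1 < t ∧ i ≠ 0 then e ⟨i - 1, hi.1⟩ else c (pre a H), ?_⟩
    intro σ p s hσ hs hp
    rw [List.range'_succ, List.map_cons] at hs
    rw [List.map_append]
    rcases p with _ | ⟨x, p⟩
    · simp only [List.nil_append, List.cons.injEq] at hs
      have : H.map σ = H := by
        conv_rhs => rw [← List.map_id H]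
        apply List.map_congr_left
        intro x hx
        rcases Nat.lt_succ_iff_lt_or_eq.1 (hH x hx) with h | rfl
        · exact hσ _ h
        · exact hs.1
      rw [this, pre_append_of_mem haH (lt_irrefl a)]
      simp
    · simp only [List.cons_append, List.cons.injEq] at hs
      have hx : x < a := hp x List.mem_cons_self
      have hpt : p.length < t := by
        have := congrArg List.length hs.2
        simp at this; omega
      have h1 : H.map σ = gblk (fun i => (h i).getD ⟨x, hx⟩) := by
        simp only [H, gblk, List.map_ofFn]
        congr 1
        funext i
        simp only [Function.comp_apply]
        rcases h i with _ | y
        · simp [hs.1]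
        · simp [hσ]
      rw [h1, pre_append (gblk_lt _), List.map_map]
      have h2 := hd (σ ∘ lft a) p s ?_ ?_ (fun y hy => hp y (List.mem_cons_of_mem _ hy))
      · have h3 := congrFun h2 (fun i => (h i).getD ⟨x, hx⟩)
        have h4 := congrFun (he ⟨x, hx⟩) ⟨p.length, hpt⟩
        simp only at h3 h4
        rw [h3, h4]
        simp [hpt]
      · intro y hy
        simp [lft, hy, hσ]
      · rw [← hs.2]
        apply List.ext_getElem
        · simp
        · intro i _ _
          simp [lft]
          congr 1
          try omega

theorem stage3 (b : ℕ) : ∀ (n m a : ℕ) (P : ℕ → Prop) [DecidablePred P], 1 ≤ a →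
    m ≤ Nat.count P n → ∃ V : List ℕ, V.length = n ∧ RW a m V ∧
      ∀ (σ : ℕ → ℕ) (p s : List ℕ), (∀ x < a, σ x < b) →
        (List.range' a m).map σ = p ++ b :: s → (∀ x ∈ p, x < b) →
        ∃ p' s', V.map σ = p' ++ b :: s' ∧ (∀ x ∈ p', x < b) ∧ P p'.length := by
  intro n
  induction n with
  | zero =>
    intro m a P _ _ hm
    obtain rfl : m = 0 := by simpa using hm
    refine ⟨[], rfl, RW.nil a, ?_⟩
    intro σ p s _ h
    simp at h
  | succ n ih =>
    intro m a P _ ha hm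
    rw [Nat.count_succ'] at hm
    by_cases h : P 0 ∧ m ≠ 0
    · obtain ⟨m, rfl⟩ := Nat.exists_eq_succ_of_ne_zero h.2
      obtain ⟨V, hl, hV, hv⟩ := ih m (a + 1) (fun k => P (k + 1)) (by omega) (by
        rw [if_pos h.1] at hm; omega)
      refine ⟨a :: V, by simp [hl], RW.param hV, ?_⟩
      intro σ p s hσ hs hp
      rw [List.range'_succ, List.map_cons] at hs
      rcases p with _ | ⟨x, p⟩
      · simp only [List.nil_append, List.cons.injEq] at hs
        exact ⟨[], V.map σ, by simp [hs.1], by simp, h.1⟩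
      · simp only [List.cons_append, List.cons.injEq] at hs
        have hx : x < b := hp x List.mem_cons_self
        obtain ⟨p', s', h1, h2, h3⟩ := hv σ p s (by
          intro y hy
          rcases Nat.lt_succ_iff_lt_or_eq.1 hy with h | rfl
          · exact hσ _ h
          · rw [hs.1]; exact hx) hs.2 (fun y hy => hp y (List.mem_cons_of_mem _ hy))
        refine ⟨x :: p', s', by simp [h1, hs.1], ?_, h3⟩
        intro y hy
        rcases List.mem_cons.1 hy with rfl | hy
        · exact hx
        · exact h2 y hy
    · obtain ⟨V, hl, hV, hv⟩ := ih m a (fun k => P (k + 1)) ha (by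
        by_cases h0 : P 0
        · have : m = 0 := by tauto
          omega
        · rw [if_neg h0] at hm; omega)
      refine ⟨0 :: V, by simp [hl], RW.const ha hV, ?_⟩
      intro σ p s hσ hs hp
      obtain ⟨p', s', h1, h2, h3⟩ := hv σ p s hσ hs hp
      refine ⟨σ 0 :: p', s', by simp [h1], ?_, h3⟩
      intro y hy
      rcases List.mem_cons.1 hy with rfl | hy
      · exact hσ 0 ha
      · exact h2 y hy

theorem pigeon (κ : Type) [Finite κ] (m : ℕ) : ∃ t, ∀ d : ℕ → κ, ∃ c, ∀ [DecidableEq κ],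
    m ≤ Nat.count (fun j => d j = c) t := by
  classical
  have := Fintype.ofFinite κ
  refine ⟨Fintype.card κ * m, fun d => ?_⟩
  obtain ⟨c, _, hc⟩ := Finset.exists_le_card_fiber_of_mul_le_card_of_maps_to
    (s := Finset.range (Fintype.card κ * m)) (t := (Finset.univ : Finset κ)) (f := d) (n := m)
    (fun _ _ => Finset.mem_univ _) ⟨d 0, Finset.mem_univ _⟩ (by simp)
  refine ⟨c, ?_⟩
  intro _
  rw [Nat.count_eq_card_filter_range]
  convert hc

theorem GR_all (k : ℕ) : ∀ a m, GR a k m := by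
  induction k with
  | zero => exact GR_zero
  | succ k IH =>
    intro a m κ _
    classical
    rcases Nat.eq_zero_or_pos a with rfl | ha
    · obtain ⟨N, hN⟩ := stage1 k IH m 0 κ
      refine ⟨N, fun χ => ?_⟩
      obtain ⟨w, hl, hw, h⟩ := hN χ
      refine ⟨w, hl, hw, ?_⟩
      by_cases hex : ∃ σ : ℕ → ℕ, RW 0 (k + 1) ((List.range' 0 m).map σ)
      · obtain ⟨σ0, h0⟩ := hex
        refine ⟨χ (w.map σ0), fun σ hσ hr => h σ σ0 hσ (by simp) hr h0 ?_⟩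
        have : ∀ l, pre 0 l = [] := by
          intro l; cases l <;> simp [pre]
        rw [this, this]
      · exact ⟨χ [], fun σ _ hr => (hex ⟨σ, hr⟩).elim⟩
    · obtain ⟨t, ht⟩ := pigeon κ m
      obtain ⟨M, hM⟩ := stage2 a t κ
      obtain ⟨N, hN⟩ := stage1 k IH M a κ
      refine ⟨N, fun χ => ?_⟩
      obtain ⟨w, hl, hw, hχ⟩ := hN χ
      let Q : List ℕ → (ℕ → ℕ) → Prop := fun l σ => (∀ x < a, σ x = x) ∧
        RW a (k + 1) ((List.range' a M).map σ) ∧ pre a ((List.range' a M).map σ) = l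
      obtain ⟨W, hlW, hW, d, hd⟩ :=
        hM (fun l => if h : ∃ σ, Q l σ then χ (w.map h.choose) else χ [])
      obtain ⟨c, hc⟩ := ht d
      obtain ⟨V, hlV, hV, hv⟩ := stage3 a t m a (fun j => d j = c) ha hc
      refine ⟨w.map (sub a W ∘ id) |>.map (sub a V), by simp [hl], ?_, c, ?_⟩
      · rw [List.map_map]
        refine hw.subst (fun x hx => by simpa [sub_lt hx] using hx) ?_
        rw [← List.map_map, Function.comp_id, map_subst_word hlW]
        refine hW.subst (fun x hx => by rwa [sub_lt hx]) ?_
        rw [map_subst_word hlV]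
        exact hV
      · intro σ hσ hr
        obtain ⟨p, s, hps, hp⟩ := hr.decomp a le_rfl (by omega)
        obtain ⟨p', s', hps', hp', hc'⟩ := hv σ p s (fun x hx => by rwa [hσ x hx]) hps hp
        have hσV : ∀ x < a, (σ ∘ sub a V) x = x := by
          intro x hx; simp [sub_lt hx, hσ x hx]
        have hd' := hd (σ ∘ sub a V) p' s' hσV
          (by rw [← List.map_map, map_subst_word hlV, hps']) hp'
        rw [hc'] at hd'
        have hq : Q (pre a (W.map (σ ∘ sub a V))) (σ ∘ sub a V ∘ sub a W) := by
          refine ⟨?_, ?_, ?_⟩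
          · intro x hx; simp [sub_lt hx, hσ x hx]
          · rw [← Function.comp_assoc, ← List.map_map, map_subst_word hlW]
            refine hW.subst (fun x hx => by rwa [hσV x hx]) ?_
            rw [← List.map_map, map_subst_word hlV]
            exact hV.subst (fun x hx => by rwa [hσ x hx]) hr
          · rw [← Function.comp_assoc, ← List.map_map, map_subst_word hlW]
        have hex : ∃ τ, Q (pre a (W.map (σ ∘ sub a V))) τ := ⟨_, hq⟩
        rw [dif_pos hex] at hd'
        have hs := hex.choose_spec
        rw [← hd', List.map_map, List.map_map]
        exact hχ _ _ hq.1 hs.1 hq.2.1 hs.2.1 (hq.2.2.trans hs.2.2.symm)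

/-- the strict index function of an edge order -/
theorem exists_idx (G : EODigraph) : ∃ (q : ℕ) (idx : G.Edge → ℕ), (∀ e, idx e < q) ∧
    (∀ j < q, ∃ e, idx e = j) ∧ Function.Injective idx ∧
    ∀ e e', G.ele e e' ↔ idx e ≤ idx e' := by
  classical
  have hfin := G.finite
  have hlin := G.lin
  let _ : LinearOrder {p : G.V × G.V // G.rel p.1 p.2} :=
    { le := G.ele
      le_refl := fun e => hlin.toIsPartialOrder.toIsPreorder.toRefl.refl e
      le_trans := fun a b c => hlin.toIsPartialOrder.toIsPreorder.toIsTrans.trans a b c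
      le_antisymm := fun a b => hlin.toIsPartialOrder.toAntisymm.antisymm a b
      le_total := fun a b => hlin.toTotal.total a b
      toDecidableLE := Classical.decRel _ }
  let _ : Fintype {p : G.V × G.V // G.rel p.1 p.2} := Fintype.ofFinite _
  let o := (Fintype.orderIsoFinOfCardEq {p : G.V × G.V // G.rel p.1 p.2} rfl).symm
  refine ⟨_, fun e => (o e : ℕ), fun e => (o e).2, fun j hj => ⟨o.symm ⟨j, hj⟩, by simp⟩,
    fun a b h => o.injective (Fin.ext h), fun e e' => ?_⟩
  have h := o.le_iff_le (x := e) (y := e')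
  exact h.symm

/-- rank of the edges of `n` disjoint edges -/
def rk (n : ℕ) (e : (Fin n × Bool) × (Fin n × Bool)) : ℕ :=
  if e.1 = e.2 then 2 * e.1.1 + e.1.2.toNat else 2 * n + e.1.1

/-- relation of `n` disjoint edges -/
def crel (n : ℕ) (x y : Fin n × Bool) : Prop :=
  x = y ∨ (x.1 = y.1 ∧ x.2 = false ∧ y.2 = true)

theorem rk_loop (n : ℕ) (x : Fin n × Bool) : rk n (x, x) = 2 * x.1 + x.2.toNat := by simp [rk]

theorem rk_edge (n : ℕ) (i : Fin n) : rk n ((i, false), (i, true)) = 2 * n + i := by simp [rk]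

theorem rk_inj {n : ℕ} (e e' : (Fin n × Bool) × (Fin n × Bool)) (he : crel n e.1 e.2)
    (he' : crel n e'.1 e'.2) (h : rk n e = rk n e') : e = e' := by
  obtain ⟨⟨i, b⟩, ⟨j, c⟩⟩ := e
  obtain ⟨⟨i', b'⟩, ⟨j', c'⟩⟩ := e'
  have hi := i.2
  have hi' := i'.2
  rcases he with he | he <;> rcases he' with he' | he'
  · simp only [Prod.mk.injEq] at he he'
    obtain ⟨rfl, rfl⟩ := he
    obtain ⟨rfl, rfl⟩ := he'
    rw [rk_loop, rk_loop] at h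
    cases b <;> cases b' <;> simp at h <;> first | omega | (obtain rfl : i = i' := by ext; omega) <;> rfl
  · simp only [Prod.mk.injEq] at he he'
    obtain ⟨rfl, rfl⟩ := he
    obtain ⟨rfl, rfl, rfl⟩ := he'
    rw [rk_loop, rk_edge] at h
    cases b <;> simp at h <;> omega
  · simp only [Prod.mk.injEq] at he he'
    obtain ⟨rfl, rfl, rfl⟩ := he
    obtain ⟨rfl, rfl⟩ := he'
    rw [rk_loop, rk_edge] at h
    cases b' <;> simp at h <;> omega
  · simp only at he he'
    obtain ⟨rfl, rfl, rfl⟩ := he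
    obtain ⟨rfl, rfl, rfl⟩ := he'
    rw [rk_edge, rk_edge] at h
    obtain rfl : i = i' := by ext; omega
    rfl

/-- `n` disjoint edges -/
def Cn (n : ℕ) : EODigraph where
  V := Fin n × Bool
  finite := inferInstance
  rel := crel n
  refl := fun x => Or.inl rfl
  ele := fun e e' => rk n e.1 ≤ rk n e'.1
  lin :=
    { refl := fun e => le_refl (rk n e.1)
      trans := fun a b c h1 h2 => le_trans (b := rk n b.1) h1 h2
      antisymm := fun a b h1 h2 => Subtype.ext (rk_inj _ _ a.2 b.2 (le_antisymm h1 h2))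
      total := fun a b => le_total (rk n a.1) (rk n b.1) }
  tidy := by
    rintro ⟨⟨x, y⟩, he⟩ ⟨⟨x', y'⟩, he'⟩ h h'
    simp only at h h'
    subst h
    refine ⟨?_, ?_⟩
    · have hx := x.1.2
      show rk n (x, x) ≤ rk n (x', y')
      rw [rk_loop]
      simp only [rk, if_neg h']
      have := Bool.toNat_le x.2
      omega
    · intro h
      simp only [Subtype.mk.injEq, Prod.mk.injEq] at h
      exact h' (h.1.symm.trans h.2)

/-- vertex map attached to a sequence of edges -/
def gF {n : ℕ} {H : EODigraph} (F : Fin n → H.Edge) (x : Fin n × Bool) : H.V :=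
  if x.2 then (F x.1).1.2 else (F x.1).1.1

/-- edges of `Cn n` -/
def mke {n : ℕ} (e : (Fin n × Bool) × (Fin n × Bool)) (h : crel n e.1 e.2) : (Cn n).Edge := ⟨e, h⟩

theorem gF_qrs {n : ℕ} {H : EODigraph} (F : Fin n → H.Edge)
    (hF : ∀ d, ∃ i, F i = d ∧ ∀ i' < i, H.elt (F i') d) : QRS (Cn n) H (gF F) := by
  have hlin := H.lin
  have hasymm : ∀ d d' : H.Edge, H.elt d d' → H.elt d' d → False := fun d d' h h' =>
    h.2 (hlin.toIsPartialOrder.toAntisymm.antisymm _ _ h.1 h'.1)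
  have hirr : ∀ d : H.Edge, ¬ H.elt d d := fun d h => h.2 rfl
  -- minimal preimages
  have key : ∀ d : H.Edge, ∃ m : (Cn n).Edge, (gF F m.1.1, gF F m.1.2) = d.1 ∧
      (∀ e : (Cn n).Edge, (gF F e.1.1, gF F e.1.2) = d.1 → (Cn n).ele m e) ∧
      ∃ i : Fin n, F i = d ∧ (∀ i' < i, H.elt (F i') d) ∧
        ((d.1.1 = d.1.2 ∧ rk n m.1 = 2 * i) ∨ (d.1.1 ≠ d.1.2 ∧ rk n m.1 = 2 * n + i)) := by
    intro d
    obtain ⟨i, hi, hmin⟩ := hF d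
    by_cases hd : d.1.1 = d.1.2
    · refine ⟨mke ((i, false), (i, false)) (Or.inl rfl), ?_, ?_, i, hi, hmin,
        Or.inl ⟨hd, by simp [mke, rk]⟩⟩
      · simp only [mke, gF, hi]
        exact Prod.ext rfl hd
      · rintro ⟨⟨x, y⟩, he⟩ hxy
        show rk n ((i, false), (i, false)) ≤ rk n (x, y)
        rw [rk_loop]
        rcases he with he | he
        · simp only at he
          subst he
          rw [show rk n (x, x) = _ from rk_loop n x]
          have hle : i ≤ x.1 := by
            by_contra hlt
            have h1 := hmin x.1 (not_le.1 hlt)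
            -- the edge `F x.1` must be a loop
            have h2 : (F x.1).1.1 = (F x.1).1.2 := by
              by_contra hne
              exact hasymm _ _ h1 (H.tidy d (F x.1) hd hne)
            have h3 : F x.1 = d := by
              apply Subtype.ext
              rw [← hxy]
              obtain ⟨j, b⟩ := x
              simp only [gF] at h2 ⊢
              cases b
              · exact Prod.ext rfl h2.symm
              · exact Prod.ext h2 rfl
            rw [h3] at h1
            exact hirr _ h1
          have : (i : ℕ) ≤ x.1 := hle
          simp only [Bool.toNat_false]
          omega
        · simp only at he
          obtain ⟨j, b⟩ := x
          obtain ⟨j', b'⟩ := y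
          simp only at he
          obtain ⟨rfl, rfl, rfl⟩ := he
          rw [rk_edge]
          simp only [Bool.toNat_false]
          omega
    · refine ⟨mke ((i, false), (i, true)) (Or.inr ⟨rfl, rfl, rfl⟩), ?_, ?_, i, hi, hmin,
        Or.inr ⟨hd, by simp [mke, rk]⟩⟩
      · simp [mke, gF, hi]
      · rintro ⟨⟨x, y⟩, he⟩ hxy
        show rk n ((i, false), (i, true)) ≤ rk n (x, y)
        rw [rk_edge]
        rcases he with he | he
        · simp only at he
          subst he
          exact absurd ((congrArg Prod.fst hxy).symm.trans (congrArg Prod.snd hxy)) hd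
        · obtain ⟨j, b⟩ := x
          obtain ⟨j', b'⟩ := y
          simp only at he
          obtain ⟨rfl, rfl, rfl⟩ := he
          rw [rk_edge]
          have h3 : F j = d := by
            apply Subtype.ext
            rw [← hxy]
            simp [gF]
          have hle : i ≤ j := by
            by_contra hlt
            have h1 := hmin j (not_le.1 hlt)
            rw [h3] at h1
            exact hirr _ h1
          have : (i : ℕ) ≤ j := hle
          omega
  refine ⟨⟨?_, ?_, ?_⟩, ?_⟩
  · intro v
    obtain ⟨m, hm, _⟩ := key ⟨(v, v), H.refl v⟩
    exact ⟨m.1.1, congrArg Prod.fst hm⟩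
  · rintro ⟨i, b⟩ ⟨j, c⟩ he
    rcases he with he | he
    · rw [he]; exact H.refl _
    · simp only at he
      obtain ⟨rfl, rfl, rfl⟩ := he
      exact (F i).2
  · intro u v huv
    obtain ⟨m, hm, _⟩ := key ⟨(u, v), huv⟩
    exact ⟨m.1.1, m.1.2, m.2, congrArg Prod.fst hm, congrArg Prod.snd hm⟩
  · intro d₁ d₂ h12
    obtain ⟨m₁, h1, h1', i, hi, hmi, hr⟩ := key d₁
    obtain ⟨m₂, h2, h2', j, hj, hmj, hr'⟩ := key d₂
    refine ⟨m₁, m₂, h1, h2, h1', h2', ?_⟩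
    have hij : i < j := by
      rcases lt_trichotomy i j with h | h | h
      · exact h
      · rw [← hi, ← hj, h] at h12
        exact (hirr _ h12).elim
      · have := hmi j h
        rw [hj] at this
        exact (hasymm _ _ h12 this).elim
    have hij' : (i : ℕ) < j := hij
    have hin := i.2
    have hlt : rk n m₁.1 < rk n m₂.1 := by
      rcases hr with ⟨ha, hr⟩ | ⟨ha, hr⟩ <;> rcases hr' with ⟨hb, hr'⟩ | ⟨hb, hr'⟩
      · omega
      · omega
      · exact (hasymm _ _ h12 (H.tidy d₂ d₁ hb ha)).elim
      · omega
    refine ⟨le_of_lt hlt, ?_⟩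
    rintro rfl
    exact lt_irrefl _ hlt

/-- the induced map on edges -/
def ehat {G H : EODigraph} (f : G.V → H.V) (hf : QRS G H f) (e : G.Edge) : H.Edge :=
  ⟨(f e.1.1, f e.1.2), hf.1.2.1 _ _ e.2⟩

theorem qrs_min {G H : EODigraph} (f : G.V → H.V) (hf : QRS G H f) (d : H.Edge) :
    ∃ m : G.Edge, ehat f hf m = d ∧
      ∀ e : G.Edge, ¬ G.ele m e → H.elt (ehat f hf e) d := by
  have hG := G.lin
  have hH := H.lin
  have hfin := G.finite
  obtain ⟨q, idx, _, _, hinj, hle⟩ := exists_idx G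
  have hex : ∃ j, ∃ e, ehat f hf e = d ∧ idx e = j := by
    obtain ⟨x, y, hxy, h1, h2⟩ := hf.1.2.2 d.1.1 d.1.2 d.2
    exact ⟨_, ⟨(x, y), hxy⟩, Subtype.ext (Prod.ext h1 h2), rfl⟩
  classical
  obtain ⟨m, hm, hmj⟩ := Nat.find_spec hex
  have hmin : ∀ e, ehat f hf e = d → G.ele m e := by
    intro e he
    refine (hle _ _).2 ?_
    rw [hmj]
    exact Nat.find_min' hex ⟨e, he, rfl⟩
  refine ⟨m, hm, fun e he => ?_⟩
  have hne : ehat f hf e ≠ d := fun h => he (hmin e h)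
  rcases hH.toTotal.total (ehat f hf e) d with h | h
  · exact ⟨h, hne⟩
  · exfalso
    obtain ⟨m₁, m₂, h1, h2, h3, h4, h5⟩ := hf.2 d (ehat f hf e) ⟨h, hne.symm⟩
    have a1 := hmin m₁ (Subtype.ext h1)
    have a2 := h4 e rfl
    have b1 := (hle _ _).1 a1
    have b2 := (hle _ _).1 a2
    have a3 := (hle _ _).1 h5.1
    exact he ((hle _ _).2 (b1.trans (a3.trans b2)))

end EOD

namespace EOD

theorem main (A B : EODigraph) (k : ℕ) (hk : 1 ≤ k) :
    ∃ C : EODigraph, ∀ χ : {f : C.V → A.V // QRS C A f} → Fin k,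
      ∃ w : C.V → B.V, QRS C B w ∧
        ∃ c : Fin k, ∀ g : {f : C.V → A.V // QRS C A f},
          (∃ f : B.V → A.V, QRS B A f ∧ g.1 = f ∘ w) → χ g = c := by
  classical
  obtain ⟨p, ia, ia_lt, ia_surj, ia_inj, ia_le⟩ := exists_idx A
  obtain ⟨q, ib, ib_lt, ib_surj, ib_inj, ib_le⟩ := exists_idx B
  obtain ⟨n, hn⟩ := GR_all p 0 q (Fin k)
  refine ⟨Cn n, fun χ => ?_⟩
  let ed : Fin n → (Cn n).Edge := fun i => mke ((i, false), (i, true)) (Or.inr ⟨rfl, rfl, rfl⟩)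
  let code : {f : (Cn n).V → A.V // QRS (Cn n) A f} → List ℕ :=
    fun g => List.ofFn (fun i => ia (ehat g.1 g.2 (ed i)))
  have code_inj : Function.Injective code := by
    intro g g' h
    have h1 := List.ofFn_injective h
    apply Subtype.ext
    funext ⟨i, b⟩
    have h2 := congrArg Subtype.val (ia_inj (congrFun h1 i))
    cases b
    · exact congrArg Prod.fst h2
    · exact congrArg Prod.snd h2
  obtain ⟨w, hl, hw, c, hc⟩ := hn (Function.extend code χ (fun _ => ⟨0, hk⟩))
  have hw_lt : ∀ i : Fin n, w[(i : ℕ)]'(by rw [hl]; exact i.2) < q := by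
    intro i
    have := hw.lt _ (List.getElem_mem (l := w) (n := (i : ℕ)) (by rw [hl]; exact i.2))
    omega
  choose F hF using fun i : Fin n => ib_surj _ (hw_lt i)
  have elt_iff : ∀ e e' : B.Edge, ib e < ib e' → B.elt e e' := by
    intro e e' h
    exact ⟨(ib_le _ _).2 h.le, fun h' => by rw [h'] at h; exact lt_irrefl _ h⟩
  have hq : QRS (Cn n) B (gF F) := by
    apply gF_qrs
    intro d
    obtain ⟨l, s, hls, hlt⟩ := hw.decomp (ib d) (Nat.zero_le _) (by have := ib_lt d; omega)
    have hlen : l.length < n := by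
      have := congrArg List.length hls
      simp at this; omega
    refine ⟨⟨l.length, hlen⟩, ib_inj ?_, fun i hi => elt_iff _ _ ?_⟩
    · rw [hF]; simp [hls]
    · have hi' : (i : ℕ) < l.length := hi
      rw [hF]
      apply hlt
      simp [hls, List.getElem_append_left hi']
  refine ⟨gF F, hq, c, ?_⟩
  rintro g ⟨f, hf, hg⟩
  let σ : ℕ → ℕ := fun j => if h : j < q then ia (ehat f hf (ib_surj j h).choose) else 0
  have hσ : ∀ e, σ (ib e) = ia (ehat f hf e) := by
    intro e
    simp only [σ, dif_pos (ib_lt e)]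
    rw [ib_inj (ib_surj (ib e) (ib_lt e)).choose_spec]
  have hcode : w.map σ = code g := by
    apply List.ext_getElem
    · simp [code, hl]
    · intro i h1 h2
      have hi : i < n := by simpa [code] using h2
      have h3 : w[i]'(by rw [hl]; exact hi) = ib (F ⟨i, hi⟩) := (hF ⟨i, hi⟩).symm
      simp only [code, List.getElem_map, List.getElem_ofFn]
      rw [h3, hσ]
      congr 1
      apply Subtype.ext
      simp only [ehat, hg]
      rfl
  rw [← hc σ (by simp) ?_, hcode, code_inj.extend_apply]
  apply RW.of_decomp
  · intro x hx
    obtain ⟨j, hj, rfl⟩ := List.mem_map.1 hx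
    have hjq : j < q := by simpa using hj
    obtain ⟨e, rfl⟩ := ib_surj j hjq
    rw [hσ]
    have := ia_lt (ehat f hf e)
    omega
  · intro j _ hj
    obtain ⟨d, rfl⟩ := ia_surj j (by omega)
    obtain ⟨m, hm, hmin⟩ := qrs_min f hf d
    have hmq := ib_lt m
    refine ⟨(List.range' 0 (ib m)).map σ, (List.range' (ib m + 1) (q - ib m - 1)).map σ, ?_, ?_⟩
    · have : List.range' 0 q =
          List.range' 0 (ib m) ++ ib m :: List.range' (ib m + 1) (q - ib m - 1) := by
        rw [← List.range'_succ]
        have := List.range'_append_1 (s := 0) (m := ib m) (n := q - ib m - 1 + 1)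
        rw [Nat.zero_add] at this
        rw [this]
        congr 1
        omega
      rw [this, List.map_append, List.map_cons, hσ, hm]
    · intro x hx
      obtain ⟨j, hj, rfl⟩ := List.mem_map.1 hx
      have hjm : j < ib m := by simpa using hj
      obtain ⟨e, rfl⟩ := ib_surj j (by omega)
      rw [hσ]
      have h := hmin e (fun h' => by have := (ib_le _ _).1 h'; omega)
      have h1 := (ia_le _ _).1 h.1
      have h2 : ia (ehat f hf e) ≠ ia d := fun h' => h.2 (ia_inj h')
      omega

end EOD

/-- The category of finite edge-ordered reflexive digraphs and quotient rigid
surjections has the dual Ramsey property. -/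
theorem stmt_8 (A B : EODigraph) (k : ℕ) (hk : 1 ≤ k) :
    ∃ C : EODigraph, ∀ χ : {f : C.V → A.V // QRS C A f} → Fin k,
      ∃ w : C.V → B.V, QRS C B w ∧
        ∃ c : Fin k, ∀ g : {f : C.V → A.V // QRS C A f},
          (∃ f : B.V → A.V, QRS B A f ∧ g.1 = f ∘ w) → χ g = c := by
  exact EOD.main A B k hk
end
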